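/- Let N ≥ 1, k ≥ 1, let χ be a Dirichlet character modulo N of conductor m, and let Q be a positive divisor of N with gcd(Q, N/Q) = 1. Let χ_Q be the Dirichlet character modulo Q defined by χ_Q(u) = χ(v) for any v ≡ u (mod Q) with v ≡ 1 (mod N/Q). Let c be the conductor of χ_Q, let χ_Q⁰ be the primitive character modulo c inducing χ_Q, and let G'(χ_Q) = Σ_{u=1}^{c} χ_Q⁰(u) e^{2πiu/c} be its Gauss sum. Choose x, y, z, w ∈ ℤ with x ≡ 1 (mod N/Q), y ≡ 1 (mod Q) and Q²xw − Nyz = Q, and define (f|_k W_Q)(τ) = Q^{k/2} (Nzτ + Qw)^{−k} f((Qxτ + y)/(Nzτ + Qw)). Then for every f ∈ M_k(Γ₀(N), χ), every Fourier coefficient of f|_k W_Q lies in the set Q^{k/2}·G'(χ_Q)·K_f = {Q^{k/2}·G'(χ_Q)·t : t ∈ K_f}. -/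

import Mathlib

open Complex UpperHalfPlane CongruenceSubgroup
open scoped ModularForm MatrixGroups Real

noncomputable section

/-- `f` has the Fourier expansion `Σ_{n ≥ 0} c n · e^{2πinτ/N}`. -/
def HasExpansion (N : ℕ) (f : ℍ → ℂ) (c : ℕ → ℂ) : Prop :=
  ∀ τ : ℍ, HasSum (fun n : ℕ => c n * Complex.exp (2 * Real.pi * Complex.I * n * (τ : ℂ) / N)) (f τ)

open Function in
/-- q-expansion at level `M` -/
def Ex (M : ℕ) (F : ℍ → ℂ) (p : PowerSeries ℂ) : Prop :=
  ∀ τ : ℍ, HasSum (fun n : ℕ => p.coeff n * Periodic.qParam (M : ℝ) τ ^ n) (F τ)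

open Function in
lemma Ex.series {M : ℕ} (hM : 0 < M) {F : ℍ → ℂ} {p : PowerSeries ℂ} (h : Ex M F p) :
    ∃ g : ℂ → ℂ, HasFPowerSeriesOnBall g (.ofScalars ℂ (fun n => p.coeff n)) 0 1 ∧
      (∀ q : ℂ, ‖q‖ < 1 → q ≠ 0 → ∃ τ : ℍ, Periodic.qParam (M : ℝ) τ = q) ∧
      ∀ τ : ℍ, F τ = g (Periodic.qParam (M : ℝ) τ) := by
  have hM' : (0 : ℝ) < M := by exact_mod_cast hM
  have hq : ∀ q : ℂ, ‖q‖ < 1 → q ≠ 0 → ∃ τ : ℍ, Periodic.qParam (M : ℝ) τ = q := by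
    intro q hq hq0
    exact ⟨⟨Periodic.invQParam M q, Periodic.im_invQParam_pos_of_norm_lt_one hM' hq hq0⟩,
      Periodic.qParam_right_inv hM'.ne' hq0⟩
  have hs : ∀ q : ℂ, ‖q‖ < 1 → Summable (fun n : ℕ => p.coeff n * q ^ n) := by
    intro q hq1
    rcases eq_or_ne q 0 with rfl | h0
    · apply summable_of_ne_finset_zero (s := {0})
      intro b hb
      simp at hb
      simp [hb]
    · obtain ⟨τ, rfl⟩ := hq q hq1 h0
      exact (h τ).summable
  refine ⟨fun q => ∑' n : ℕ, p.coeff n * q ^ n, ?_, hq, fun τ => (h τ).tsum_eq.symm⟩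
  constructor
  · refine le_of_forall_lt_imp_le_of_dense fun r hr ↦ ?_
    lift r to NNReal using hr.ne_top
    apply FormalMultilinearSeries.le_radius_of_summable
    have := (hs (r : ℂ) (by simpa using hr)).norm
    simpa [norm_mul, mul_comm, mul_left_comm, mul_assoc] using this
  · simp
  · intro y hy
    rw [← ENNReal.coe_one, Metric.eball_coe, NNReal.coe_one, mem_ball_zero_iff] at hy
    have := (hs y hy).hasSum
    simpa [mul_comm] using this

lemma Ex.unique {M : ℕ} (hM : 0 < M) {F : ℍ → ℂ} {p p' : PowerSeries ℂ} (h : Ex M F p)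
    (h' : Ex M F p') : p = p' := by
  obtain ⟨g, hg, hq, hF⟩ := h.series hM
  obtain ⟨g', hg', -, hF'⟩ := h'.series hM
  have h1 : g =ᶠ[nhdsWithin 0 {0}ᶜ] g' := by
    have : Metric.ball (0:ℂ) 1 ∈ nhdsWithin (0:ℂ) {0}ᶜ :=
      mem_nhdsWithin_of_mem_nhds (Metric.ball_mem_nhds _ one_pos)
    filter_upwards [self_mem_nhdsWithin, this] with q hq0 hq1
    obtain ⟨τ, rfl⟩ := hq q (by simpa using hq1) hq0
    rw [← hF, ← hF']
  have h2 := (hg.hasFPowerSeriesAt.continuousAt.eventuallyEq_nhds_iff_eventuallyEq_nhdsNE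
    hg'.hasFPowerSeriesAt.continuousAt).mp h1
  have h3 := hg.hasFPowerSeriesAt.eq_formalMultilinearSeries_of_eventually hg'.hasFPowerSeriesAt h2
  ext n
  have := congrArg (fun s => FormalMultilinearSeries.coeff s n) h3
  simpa [FormalMultilinearSeries.coeff_ofScalars] using this

lemma Ex.add {M : ℕ} {F G : ℍ → ℂ} {p q : PowerSeries ℂ} (h : Ex M F p)
    (h' : Ex M G q) : Ex M (F + G) (p + q) := by
  intro τ
  simpa [add_mul] using (h τ).add (h' τ)

lemma Ex.sub {M : ℕ} {F G : ℍ → ℂ} {p q : PowerSeries ℂ} (h : Ex M F p)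
    (h' : Ex M G q) : Ex M (F - G) (p - q) := by
  intro τ
  simpa [sub_mul] using (h τ).sub (h' τ)

lemma Ex.smul {M : ℕ} {F : ℍ → ℂ} {p : PowerSeries ℂ} (t : ℂ) (h : Ex M F p) :
    Ex M (t • F) (t • p) := by
  intro τ
  simpa [mul_assoc] using (h τ).mul_left t

lemma Ex.zero (M : ℕ) : Ex M 0 0 := by
  intro τ
  simp [hasSum_zero]

lemma Ex.const (M : ℕ) (c : ℂ) : Ex M (fun _ => c) (PowerSeries.C c) := by
  intro τ
  convert hasSum_ite_eq (0 : ℕ) c using 2 with n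
  rw [PowerSeries.coeff_C]
  split_ifs with h <;> simp [h]

lemma Ex.mul {M : ℕ} {F G : ℍ → ℂ} {p q : PowerSeries ℂ} (h : Ex M F p)
    (h' : Ex M G q) : Ex M (F * G) (p * q) := by
  intro τ
  have h1 := (h τ).summable.norm
  have h2 := (h' τ).summable.norm
  have h3 := tsum_mul_tsum_eq_tsum_sum_antidiagonal_of_summable_norm h1 h2
  rw [(h τ).tsum_eq, (h' τ).tsum_eq] at h3
  have h4 := (summable_norm_sum_mul_antidiagonal_of_summable_norm h1 h2).of_norm.hasSum
  rw [← h3] at h4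
  refine h4.congr_fun ?_ |> fun x => x
  intro n
  rw [PowerSeries.coeff_mul, Finset.sum_mul]
  refine Finset.sum_congr rfl fun x hx => ?_
  rw [← Finset.HasAntidiagonal.mem_antidiagonal.mp hx, pow_add]
  ring

lemma Ex.eq_of_same {M : ℕ} {F G : ℍ → ℂ} {p : PowerSeries ℂ} (h : Ex M F p)
    (h' : Ex M G p) : F = G := by
  ext τ
  exact (h τ).unique (h' τ)

open scoped Manifold in
lemma Ex.mdiff {M : ℕ} (hM : 0 < M) {F : ℍ → ℂ} {p : PowerSeries ℂ} (h : Ex M F p) :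
    MDiff F := by
  have hM' : (0 : ℝ) < M := by exact_mod_cast hM
  obtain ⟨g, hg, hq, hF⟩ := h.series hM
  intro τ
  rw [UpperHalfPlane.mdifferentiableAt_iff]
  have h1 : DifferentiableAt ℂ (fun z => g (Function.Periodic.qParam (M : ℝ) z)) (τ : ℂ) := by
    have ha : DifferentiableAt ℂ g (Function.Periodic.qParam (M : ℝ) τ) := by
      apply (hg.differentiableOn).differentiableAt
      apply Metric.isOpen_eball.mem_nhds
      rw [← ENNReal.coe_one, Metric.eball_coe, NNReal.coe_one, mem_ball_zero_iff]
      exact Function.Periodic.norm_qParam_lt_one hM' τ.im_pos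
    have hb : DifferentiableAt ℂ (Function.Periodic.qParam (M : ℝ)) (τ : ℂ) := by
      unfold Function.Periodic.qParam
      fun_prop
    exact ha.comp _ hb
  refine h1.congr_of_eventuallyEq ?_
  have : {z : ℂ | 0 < z.im} ∈ nhds (τ : ℂ) :=
    (isOpen_lt continuous_const Complex.continuous_im).mem_nhds τ.im_pos
  filter_upwards [this] with z hz
  simp only [Function.comp]
  rw [ofComplex_apply_of_im_pos hz, hF]

lemma Ex.bdd {M : ℕ} (hM : 0 < M) {F : ℍ → ℂ} {p : PowerSeries ℂ} (h : Ex M F p) :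
    IsBoundedAtImInfty F := by
  have hM' : (0 : ℝ) < M := by exact_mod_cast hM
  exact isBoundedAtImInfty_of_hasSum_qExpansion (c := fun n => p.coeff n) hM' h

lemma qParam_pow_mul (M j : ℕ) (hM : 0 < M) (hj : 0 < j) (z : ℂ) :
    Function.Periodic.qParam ((M * j : ℕ) : ℝ) z ^ j = Function.Periodic.qParam (M : ℝ) z := by
  unfold Function.Periodic.qParam
  rw [← Complex.exp_nat_mul]
  congr 1
  have : (M : ℂ) ≠ 0 := by exact_mod_cast hM.ne'
  have : (j : ℂ) ≠ 0 := by exact_mod_cast hj.ne'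
  push_cast
  field_simp

/-- spreading out a series -/
def spread (j : ℕ) (p : PowerSeries ℂ) : PowerSeries ℂ :=
  PowerSeries.mk fun n => if j ∣ n then p.coeff (n / j) else 0

lemma coeff_spread_mul {j : ℕ} (hj : 0 < j) (p : PowerSeries ℂ) (n : ℕ) :
    (spread j p).coeff (n * j) = p.coeff n := by
  simp [spread, hj]

lemma hasSum_spread {j : ℕ} (hj : 0 < j) (p : PowerSeries ℂ) (q s : ℂ)
    (h : HasSum (fun n => p.coeff n * (q ^ j) ^ n) s) :
    HasSum (fun n => (spread j p).coeff n * q ^ n) s := by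
  have hinj : Function.Injective (fun n : ℕ => n * j) := fun a b h => Nat.eq_of_mul_eq_mul_right hj h
  rw [← hinj.hasSum_iff]
  · convert h using 2 with n
    simp only [Function.comp]
    rw [coeff_spread_mul hj, ← pow_mul, mul_comm n j]
  · intro x hx
    have : ¬ j ∣ x := by
      rintro ⟨y, rfl⟩
      exact hx ⟨y, mul_comm _ _⟩
    simp [spread, this]

lemma Ex.level {M j : ℕ} (hM : 0 < M) (hj : 0 < j) {F : ℍ → ℂ} {p : PowerSeries ℂ}
    (h : Ex M F p) : Ex (M * j) F (spread j p) := by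
  intro τ
  apply hasSum_spread hj
  rw [qParam_pow_mul M j hM hj]
  exact h τ

lemma HasExpansion.ex {M : ℕ} {F : ℍ → ℂ} {c : ℕ → ℂ} (h : HasExpansion M F c) :
    Ex M F (PowerSeries.mk c) := by
  intro τ
  convert h τ using 3 with n
  · simp
  · unfold Function.Periodic.qParam
    rw [← Complex.exp_nat_mul]
    congr 1
    push_cast
    ring

lemma Ex.ne_zero {M : ℕ} {F : ℍ → ℂ} {p : PowerSeries ℂ} (h : Ex M F p) (hF : F ≠ 0) : p ≠ 0 := by
  rintro rfl
  exact hF (h.eq_of_same (Ex.zero M))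

/-- semilinear data -/
structure Semi (M : ℕ) [NeZero M] where
  phi : ℂ →+ ℂ
  lam : (ZMod M)ˣ
  phi_one : phi 1 = 1
  phi_zeta : ∀ (j : ZMod M) (x : ℂ),
    phi (ZMod.stdAddChar j * x) = ZMod.stdAddChar ((lam : ZMod M) * j) * phi x

namespace Semi

variable {M : ℕ} [NeZero M] (S : Semi M)

/-- the multiplicative elements -/
def E : Subring ℂ where
  carrier := {e | ∀ x, S.phi (e * x) = S.phi e * S.phi x}
  mul_mem' := by
    intro a b ha hb x
    rw [mul_assoc, ha, hb, ha b, mul_assoc]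
  one_mem' := by intro x; simp [S.phi_one]
  add_mem' := by
    intro a b ha hb x
    rw [add_mul, map_add, map_add, ha, hb, add_mul]
  zero_mem' := by intro x; simp
  neg_mem' := by
    intro a ha x
    rw [neg_mul, map_neg, map_neg, ha, neg_mul]

lemma mem_E {e : ℂ} : e ∈ S.E ↔ ∀ x, S.phi (e * x) = S.phi e * S.phi x := Iff.rfl

lemma zeta_mem (j : ZMod M) : (ZMod.stdAddChar j : ℂ) ∈ S.E := by
  intro x
  have := S.phi_zeta j 1
  rw [mul_one, S.phi_one, mul_one] at this
  rw [S.phi_zeta, this]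

lemma phi_stdAddChar (j : ZMod M) :
    S.phi (ZMod.stdAddChar j) = ZMod.stdAddChar ((S.lam : ZMod M) * j) := by
  have := S.phi_zeta j 1
  rwa [mul_one, S.phi_one, mul_one] at this

lemma phi_rat_mul (r : ℚ) (x : ℂ) : S.phi (r * x) = r * S.phi x := by
  have := map_ratCast_smul S.phi ℂ ℂ r x
  simpa using this

lemma phi_rat (r : ℚ) : S.phi r = r := by
  have := S.phi_rat_mul r 1
  simpa [S.phi_one] using this

lemma rat_mem (r : ℚ) : (r : ℂ) ∈ S.E := by
  intro x
  rw [phi_rat, phi_rat_mul]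

lemma phi_ne_zero {e : ℂ} (he : e ∈ S.E) (h0 : e ≠ 0) : S.phi e ≠ 0 := by
  intro h
  have := he e⁻¹
  rw [mul_inv_cancel₀ h0, S.phi_one, h, zero_mul] at this
  exact one_ne_zero this

/-- coefficientwise action -/
def ser (p : PowerSeries ℂ) : PowerSeries ℂ := PowerSeries.mk fun n => S.phi (p.coeff n)

@[simp] lemma coeff_ser (p : PowerSeries ℂ) (n : ℕ) : (S.ser p).coeff n = S.phi (p.coeff n) := by
  simp [ser]

/-- coefficients in E -/
def InE (p : PowerSeries ℂ) : Prop := ∀ n, p.coeff n ∈ S.E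

variable {S}

lemma ser_add (p q : PowerSeries ℂ) : S.ser (p + q) = S.ser p + S.ser q := by
  ext n; simp

lemma ser_sub (p q : PowerSeries ℂ) : S.ser (p - q) = S.ser p - S.ser q := by
  ext n; simp

lemma ser_zero : S.ser 0 = 0 := by
  ext n; simp

lemma ser_smul (t : ℂ) {p : PowerSeries ℂ} (hp : S.InE p) : S.ser (t • p) = S.phi t • S.ser p := by
  ext n
  simp only [coeff_ser, PowerSeries.coeff_smul, smul_eq_mul]
  rw [mul_comm, hp n, mul_comm]

lemma ser_mul (p : PowerSeries ℂ) {q : PowerSeries ℂ} (hq : S.InE q) :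
    S.ser (p * q) = S.ser p * S.ser q := by
  ext n
  simp only [coeff_ser, PowerSeries.coeff_mul, map_sum]
  refine Finset.sum_congr rfl fun x _ => ?_
  rw [mul_comm, hq, mul_comm]

lemma InE.add {p q : PowerSeries ℂ} (hp : S.InE p) (hq : S.InE q) : S.InE (p + q) := fun n => by
  simpa using S.E.add_mem (hp n) (hq n)

lemma InE.sub {p q : PowerSeries ℂ} (hp : S.InE p) (hq : S.InE q) : S.InE (p - q) := fun n => by
  simpa using S.E.sub_mem (hp n) (hq n)

lemma InE.mul {p q : PowerSeries ℂ} (hp : S.InE p) (hq : S.InE q) : S.InE (p * q) := fun n => by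
  rw [PowerSeries.coeff_mul]
  exact S.E.sum_mem fun x _ => S.E.mul_mem (hp _) (hq _)

lemma ser_ne_zero {p : PowerSeries ℂ} (hp : S.InE p) (h0 : p ≠ 0) : S.ser p ≠ 0 := by
  intro h
  apply h0
  ext n
  by_contra h1
  have := congrArg (PowerSeries.coeff n) h
  simp only [coeff_ser, map_zero] at this
  exact S.phi_ne_zero (hp n) (by simpa using h1) this

variable (S)

/-- conjugation relation mod M -/
def Rel (g g' : SL(2, ℤ)) : Prop :=
  ((g' 0 0 : ℤ) : ZMod M) = ((g 0 0 : ℤ) : ZMod M) ∧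
  ((g' 0 1 : ℤ) : ZMod M) = (S.lam : ZMod M) * ((g 0 1 : ℤ) : ZMod M) ∧
  (S.lam : ZMod M) * ((g' 1 0 : ℤ) : ZMod M) = ((g 1 0 : ℤ) : ZMod M) ∧
  ((g' 1 1 : ℤ) : ZMod M) = ((g 1 1 : ℤ) : ZMod M)

variable {S}

lemma Rel.one : S.Rel 1 1 := by
  simp [Rel]

lemma Rel.mul {g g' h h' : SL(2, ℤ)} (hg : S.Rel g g') (hh : S.Rel h h') :
    S.Rel (g * h) (g' * h') := by
  obtain ⟨a, b, c, d⟩ := hg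
  obtain ⟨a', b', c', d'⟩ := hh
  simp only [Rel, Matrix.SpecialLinearGroup.coe_mul, Matrix.mul_apply, Fin.sum_univ_two,
    Int.cast_add, Int.cast_mul]
  refine ⟨?_, ?_, ?_, ?_⟩
  · rw [a, a', b, ← c']; ring
  · rw [a, b, b', d']; ring
  · rw [mul_add, ← mul_assoc, c, a', d, ← c']; ring
  · rw [d, d', b', ← c]; ring

variable (S)

/-- compatible pairs -/
def Comp (k : ℤ) (F F' : ℍ → ℂ) : Prop :=
  ∀ g g' : SL(2, ℤ), S.Rel g g' → ∃ p : PowerSeries ℂ, Ex M (F ∣[k] g) p ∧ Ex M (F' ∣[k] g') (S.ser p)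

/-- compatible pairs, rational over E -/
def CompQ (k : ℤ) (F F' : ℍ → ℂ) : Prop :=
  ∀ g g' : SL(2, ℤ), S.Rel g g' → ∃ p : PowerSeries ℂ, S.InE p ∧
    Ex M (F ∣[k] g) p ∧ Ex M (F' ∣[k] g') (S.ser p)

variable {S}

lemma CompQ.comp {k : ℤ} {F F' : ℍ → ℂ} (h : S.CompQ k F F') : S.Comp k F F' := fun g g' r => by
  obtain ⟨p, _, h1, h2⟩ := h g g' r
  exact ⟨p, h1, h2⟩

lemma Comp.zero (k : ℤ) : S.Comp k 0 0 := fun g g' r => by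
  refine ⟨0, ?_, ?_⟩
  · rw [SlashAction.zero_slash]; exact Ex.zero M
  · rw [SlashAction.zero_slash, ser_zero]; exact Ex.zero M

lemma Comp.add {k : ℤ} {F F' G G' : ℍ → ℂ} (h : S.Comp k F F') (h' : S.Comp k G G') :
    S.Comp k (F + G) (F' + G') := fun g g' r => by
  obtain ⟨p, h1, h2⟩ := h g g' r
  obtain ⟨q, h3, h4⟩ := h' g g' r
  refine ⟨p + q, ?_, ?_⟩
  · rw [SlashAction.add_slash]; exact h1.add h3
  · rw [SlashAction.add_slash, ser_add]; exact h2.add h4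

lemma CompQ.sub {k : ℤ} {F F' G G' : ℍ → ℂ} (h : S.CompQ k F F') (h' : S.CompQ k G G') :
    S.CompQ k (F - G) (F' - G') := fun g g' r => by
  obtain ⟨p, e1, h1, h2⟩ := h g g' r
  obtain ⟨q, e2, h3, h4⟩ := h' g g' r
  refine ⟨p - q, e1.sub e2, ?_, ?_⟩
  · rw [sub_eq_add_neg, SlashAction.add_slash, SlashAction.neg_slash, ← sub_eq_add_neg]
    exact h1.sub h3
  · rw [sub_eq_add_neg, SlashAction.add_slash, SlashAction.neg_slash, ← sub_eq_add_neg, ser_sub]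
    exact h2.sub h4

lemma CompQ.smul {k : ℤ} {F F' : ℍ → ℂ} (t : ℂ) (h : S.CompQ k F F') :
    S.Comp k (t • F) (S.phi t • F') := fun g g' r => by
  obtain ⟨p, e, h1, h2⟩ := h g g' r
  refine ⟨t • p, ?_, ?_⟩
  · rw [ModularForm.SL_smul_slash]; exact h1.smul t
  · rw [ModularForm.SL_smul_slash, ser_smul t e]; exact h2.smul _

lemma CompQ.smulQ {k : ℤ} {F F' : ℍ → ℂ} {t : ℂ} (ht : t ∈ S.E) (h : S.CompQ k F F') :
    S.CompQ k (t • F) (S.phi t • F') := fun g g' r => by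
  obtain ⟨p, e, h1, h2⟩ := h g g' r
  refine ⟨t • p, fun n => by simpa using S.E.mul_mem ht (e n), ?_, ?_⟩
  · rw [ModularForm.SL_smul_slash]; exact h1.smul t
  · rw [ModularForm.SL_smul_slash, ser_smul t e]; exact h2.smul _

lemma Comp.mul {k l : ℤ} {F F' G G' : ℍ → ℂ} (h : S.Comp k F F') (h' : S.CompQ l G G') :
    S.Comp (k + l) (F * G) (F' * G') := fun g g' r => by
  obtain ⟨p, h1, h2⟩ := h g g' r
  obtain ⟨q, e, h3, h4⟩ := h' g g' r
  refine ⟨p * q, ?_, ?_⟩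
  · rw [ModularForm.mul_slash_SL2]; exact h1.mul h3
  · rw [ModularForm.mul_slash_SL2, ser_mul p e]; exact h2.mul h4

lemma CompQ.mul {k l : ℤ} {F F' G G' : ℍ → ℂ} (h : S.CompQ k F F') (h' : S.CompQ l G G') :
    S.CompQ (k + l) (F * G) (F' * G') := fun g g' r => by
  obtain ⟨p, e1, h1, h2⟩ := h g g' r
  obtain ⟨q, e, h3, h4⟩ := h' g g' r
  refine ⟨p * q, e1.mul e, ?_, ?_⟩
  · rw [ModularForm.mul_slash_SL2]; exact h1.mul h3
  · rw [ModularForm.mul_slash_SL2, ser_mul p e]; exact h2.mul h4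

lemma CompQ.slash {k : ℤ} {F F' : ℍ → ℂ} {g g' : SL(2, ℤ)} (r : S.Rel g g') (h : S.CompQ k F F') :
    S.CompQ k (F ∣[k] g) (F' ∣[k] g') := fun a a' s => by
  obtain ⟨p, e, h1, h2⟩ := h _ _ (r.mul s)
  refine ⟨p, e, ?_, ?_⟩
  · rwa [← SlashAction.slash_mul]
  · rwa [← SlashAction.slash_mul]

lemma CompQ.one : S.CompQ 0 1 1 := fun g g' r => by
  have h1 : ∀ g : SL(2, ℤ), (1 : ℍ → ℂ) ∣[(0 : ℤ)] g = 1 := fun g => by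
    exact ModularForm.is_invariant_one g
  refine ⟨1, ?_, ?_, ?_⟩
  · intro n
    rw [PowerSeries.coeff_one]
    split_ifs
    · exact S.E.one_mem
    · exact S.E.zero_mem
  · rw [h1]
    have := Ex.const M 1
    rwa [map_one] at this
  · rw [h1]
    have := Ex.const M 1
    rw [map_one] at this
    have e : S.ser 1 = 1 := by
      ext n
      rw [coeff_ser, PowerSeries.coeff_one]
      split_ifs
      · exact S.phi_one
      · simp
    rw [e]
    exact this

lemma CompQ.prod {ι : Type*} {k : ℤ} (F F' : ι → ℍ → ℂ) (s : Finset ι)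
    (h : ∀ i ∈ s, S.CompQ k (F i) (F' i)) :
    S.CompQ (s.card * k) (∏ i ∈ s, F i) (∏ i ∈ s, F' i) := by
  classical
  induction s using Finset.induction_on with
  | empty => simpa using CompQ.one
  | insert a s ha ih =>
    rw [Finset.prod_insert ha, Finset.prod_insert ha, Finset.card_insert_of_notMem ha]
    have := (h a (Finset.mem_insert_self a s)).mul
      (ih fun i hi => h i (Finset.mem_insert_of_mem hi))
    convert this using 1
    push_cast; ring

lemma Comp.sum {ι : Type*} {k : ℤ} (F : ι → ℍ → ℂ) (s : Finset ι)
    (h : ∀ i ∈ s, ∃ F', S.Comp k (F i) F') : ∃ F', S.Comp k (∑ i ∈ s, F i) F' := by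
  classical
  induction s using Finset.induction_on with
  | empty => exact ⟨0, by simpa using Comp.zero k⟩
  | insert a s ha ih =>
    obtain ⟨F', hF'⟩ := h a (Finset.mem_insert_self a s)
    obtain ⟨G', hG'⟩ := ih fun i hi => h i (Finset.mem_insert_of_mem hi)
    rw [Finset.sum_insert ha]
    exact ⟨_, hF'.add hG'⟩

end Semi

open ModularForm EisensteinSeries in
lemma levelOne_slash {k : ℤ} (f : ModularForm 𝒮ℒ k) (g : SL(2, ℤ)) : ⇑f ∣[k] g = ⇑f := by
  rw [ModularForm.SL_slash]
  exact SlashInvariantFormClass.slash_action_eq f _ ⟨g, rfl⟩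

lemma levelOne_ex {k : ℤ} (f : ModularForm 𝒮ℒ k) (M : ℕ) (hM : 0 < M) :
    Ex M f (spread M (qExpansion 1 f)) := by
  have h1 : Ex 1 f (qExpansion 1 f) := by
    intro τ
    have := UpperHalfPlane.hasSum_qExpansion (h := 1) (f := f) one_pos
      (SlashInvariantFormClass.periodic_comp_ofComplex f one_mem_strictPeriods_SL)
      (ModularFormClass.holo f) (ModularFormClass.bdd_at_infty f) τ
    simpa using this
  have := h1.level (j := M) one_pos hM
  rwa [one_mul] at this

namespace Semi
variable {M : ℕ} [NeZero M] {S : Semi M}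

lemma compQ_of_rat {k : ℤ} (f : ModularForm 𝒮ℒ k)
    (h : ∀ n, ∃ r : ℚ, (qExpansion 1 f).coeff n = r) : S.CompQ k f f := fun g g' _ => by
  have h' : ∀ n, ∃ r : ℚ, (spread M (qExpansion 1 f)).coeff n = r := by
    intro n
    simp only [spread, PowerSeries.coeff_mk]
    split_ifs
    · exact h _
    · exact ⟨0, by simp⟩
  refine ⟨spread M (qExpansion 1 f), ?_, ?_, ?_⟩
  · intro n
    obtain ⟨r, hr⟩ := h' n
    rw [hr]; exact S.rat_mem r
  · rw [levelOne_slash]; exact levelOne_ex f M (NeZero.pos M)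
  · rw [levelOne_slash]
    convert levelOne_ex f M (NeZero.pos M) using 1
    ext n
    obtain ⟨r, hr⟩ := h' n
    rw [coeff_ser, hr, phi_rat]

open ModularForm EisensteinSeries

lemma compQ_E {k : ℕ} (hk : 3 ≤ k) (he : Even k) : S.CompQ k (ModularForm.E hk) (ModularForm.E hk) := by
  apply compQ_of_rat
  intro n
  rw [E_qExpansion_coeff hk he]
  split_ifs
  · exact ⟨1, by simp⟩
  · exact ⟨-(2 * k / (bernoulli k)) * (ArithmeticFunction.sigma (k - 1) n), by push_cast; rfl⟩

lemma compQ_disc : S.CompQ 12 discriminant discriminant := by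
  have h4 : S.CompQ 4 E₄ E₄ := compQ_E (k := 4) (by norm_num) (by decide)
  have h6 : S.CompQ 6 E₆ E₆ := compQ_E (k := 6) (by norm_num) (by decide)
  have e : (discriminant : ℍ → ℂ) = ((1 / 1728 : ℚ) : ℂ) • (⇑E₄ * ⇑E₄ * ⇑E₄ - ⇑E₆ * ⇑E₆) := by
    ext z
    rw [discriminant_eq_E₄_cube_sub_E₆_sq]
    simp only [Pi.smul_apply, Pi.sub_apply, Pi.mul_apply, smul_eq_mul]
    push_cast; ring
  generalize (E₄ : ℍ → ℂ) = A at *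
  generalize (E₆ : ℍ → ℂ) = B at *
  have h1 : S.CompQ 12 (A * A * A) (A * A * A) := by
    have := (h4.mul h4).mul h4
    norm_num at this
    exact this
  have h2 : S.CompQ 12 (B * B) (B * B) := by
    have := h6.mul h6
    norm_num at this
    exact this
  have h' := (h1.sub h2).smulQ (S.rat_mem (1 / 1728))
  rw [phi_rat] at h'
  rw [e]
  exact h'

lemma levelOne_comp (n : ℕ) : ∀ {k : ℤ} (_ : k < n) (f : ModularForm 𝒮ℒ k), ∃ f', S.Comp k f f' := by
  induction n with
  | zero =>
    intro k hk f
    rw [ModularFormClass.levelOne_neg_weight_eq_zero (by simpa using hk) f]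
    exact ⟨0, Comp.zero k⟩
  | succ n ih =>
    intro k hk f
    rcases lt_or_eq_of_le (Int.le_of_lt_add_one (by exact_mod_cast hk : k < (n : ℤ) + 1)) with h | h
    · exact ih h f
    · subst h
      rcases Nat.even_or_odd n with he | ho
      swap
      · rw [levelOne_odd_weight_eq_zero (by exact_mod_cast ho) f]
        exact ⟨0, by simpa using Comp.zero _⟩
      by_cases h0 : n = 0
      · subst h0
        obtain ⟨c, hc⟩ := ModularFormClass.levelOne_weight_zero_const f
        have := (CompQ.one (S := S)).smul c
        refine ⟨S.phi c • 1, ?_⟩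
        rw [hc]
        have e : (Function.const ℍ c) = c • (1 : ℍ → ℂ) := by ext; simp
        rw [e]
        exact this
      by_cases h2 : n = 2
      · subst h2
        rw [rank_zero_iff_forall_zero.mp levelOne_weight_two_rank_zero f]
        exact ⟨0, by simpa using Comp.zero _⟩
      have h3 : 3 ≤ n := by
        rcases he with ⟨m, rfl⟩; omega
      set a := (qExpansion 1 f).coeff 0 with ha
      have hz : (qExpansion 1 ⇑(f - a • ModularForm.E h3)).coeff 0 = 0 := by
        have e1 := ModularForm.qExpansion_sub (Γ := 𝒮ℒ) (h := 1) one_pos one_mem_strictPeriods_SL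
          (a := n) (b := n) f (a • ModularForm.E h3)
        have e2 := ModularForm.qExpansion_smul (Γ := 𝒮ℒ) (h := 1) one_pos one_mem_strictPeriods_SL
          (k := n) a (ModularForm.E h3)
        rw [FunLike.coe_sub, e1, FunLike.coe_smul, e2]
        rw [map_sub, PowerSeries.coeff_smul, E_qExpansion_coeff_zero h3 he, ← ha, smul_eq_mul, mul_one, sub_self]
      set g := CuspForm.discriminantEquiv (toCuspForm (f - a • ModularForm.E h3) hz)
      obtain ⟨g', hg'⟩ := ih (by omega) g
      have hm := hg'.mul compQ_disc
      have hm2 := (compQ_E (S := S) h3 he).smul a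
      rw [sub_add_cancel] at hm
      have hf : ⇑f = ⇑g * discriminant + a • ⇑(ModularForm.E h3) := by
        ext z
        have e := discriminant_mul_discriminantEquiv_apply (toCuspForm (f - a • ModularForm.E h3) hz) z
        rw [toCuspForm_apply] at e
        simp only [Pi.add_apply, Pi.mul_apply, Pi.smul_apply]
        rw [mul_comm, e]
        simp
      rw [hf]
      exact ⟨_, hm.add hm2⟩

end Semi

namespace Eis
set_option linter.unusedSectionVars false
open EisensteinSeries
variable {M : ℕ} [NeZero M]

/-- summand -/
def term (v : Fin 2 → ZMod M) (τ : ℍ) (n : Fin 2 → ℤ) : ℂ :=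
  open scoped Classical in
  if (fun i => ((n i : ℤ) : ZMod M)) = v then eisSummand 3 n τ else 0

/-- unnormalised series -/
def G (v : Fin 2 → ZMod M) (τ : ℍ) : ℂ := ∑' n, term v τ n

lemma summable_term (v : Fin 2 → ZMod M) (τ : ℍ) : Summable (term v τ) := by
  refine Summable.of_norm_bounded (summable_norm_eisSummand (k := 3) le_rfl τ) fun n => ?_
  unfold term
  split_ifs
  · exact le_rfl
  · simp

lemma term_smul (v : Fin 2 → ZMod M) (γ : SL(2, ℤ)) (τ : ℍ) (n : Fin 2 → ℤ) :
    term v (γ • τ) n = denom γ τ ^ (3 : ℤ) *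
      term (Matrix.vecMul v (γ.map (Int.castRingHom (ZMod M))).1) τ (Matrix.vecMul n γ.1) := by
  unfold term
  have : ((fun i => ((Matrix.vecMul n γ.1 i : ℤ) : ZMod M)) =
      Matrix.vecMul v (γ.map (Int.castRingHom (ZMod M))).1) ↔
      ((fun i => ((n i : ℤ) : ZMod M)) = v) := by
    have e : (fun i => ((Matrix.vecMul n γ.1 i : ℤ) : ZMod M)) =
        Matrix.vecMul (fun i => ((n i : ℤ) : ZMod M)) (γ.map (Int.castRingHom (ZMod M))).1 := by
      ext i
      simp [Matrix.vecMul, dotProduct]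
    rw [e]
    constructor
    · intro h
      have := congrArg (fun u => Matrix.vecMul u ((γ.map (Int.castRingHom (ZMod M)))⁻¹).1) h
      simp only [Matrix.vecMul_vecMul, ← Matrix.SpecialLinearGroup.coe_mul, mul_inv_cancel,
        Matrix.SpecialLinearGroup.coe_one, Matrix.vecMul_one] at this
      exact this
    · intro h; rw [h]
  by_cases h : (fun i => ((n i : ℤ) : ZMod M)) = v
  · rw [if_pos h, if_pos (this.mpr h), eisSummand_SL2_apply]
  · rw [if_neg h, if_neg (fun h' => h (this.mp h')), mul_zero]

lemma G_slash (v : Fin 2 → ZMod M) (γ : SL(2, ℤ)) :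
    G v ∣[(3 : ℤ)] γ = G (Matrix.vecMul v (γ.map (Int.castRingHom (ZMod M))).1) := by
  ext τ
  rw [ModularForm.SL_slash_apply, zpow_neg,
    mul_inv_eq_iff_eq_mul₀ (zpow_ne_zero _ <| denom_ne_zero _ τ)]
  unfold G
  simp_rw [term_smul, tsum_mul_left]
  rw [mul_comm]
  congr 1
  let e : (Fin 2 → ℤ) ≃ (Fin 2 → ℤ) :=
    { toFun := fun n => Matrix.vecMul n γ.1
      invFun := fun n => Matrix.vecMul n (γ⁻¹).1
      left_inv := fun n => by
        simp only [Matrix.vecMul_vecMul, ← Matrix.SpecialLinearGroup.coe_mul, mul_inv_cancel,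
          Matrix.SpecialLinearGroup.coe_one, Matrix.vecMul_one]
      right_inv := fun n => by
        simp only [Matrix.vecMul_vecMul, ← Matrix.SpecialLinearGroup.coe_mul, inv_mul_cancel,
          Matrix.SpecialLinearGroup.coe_one, Matrix.vecMul_one] }
  exact e.tsum_eq _

/-- the constant -/
def cst : ℂ := (-2 * π * Complex.I) ^ 3 / (Nat.factorial 2)

lemma cst_ne_zero : cst ≠ 0 := by
  unfold cst
  have : (π : ℂ) ≠ 0 := by exact_mod_cast Real.pi_ne_zero
  have := Complex.I_ne_zero
  simp_all [Nat.factorial]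

open scoped Classical in
lemma inner_sum (z : ℍ) (b : ZMod M) :
    ∑' d : ℤ, (if (d : ZMod M) = b then 1 / ((z : ℂ) + d) ^ 3 else 0) =
      cst * ((M : ℂ) ^ 3)⁻¹ * ∑' r : ℕ+, (r : ℂ) ^ 2 * (ZMod.stdAddChar ((r : ℕ) * b : ZMod M) *
        Function.Periodic.qParam (M : ℝ) z ^ (r : ℕ)) := by
  have hM : (M : ℂ) ≠ 0 := by exact_mod_cast NeZero.ne M
  have hMp : (0 : ℝ) < M := by exact_mod_cast NeZero.pos M
  obtain ⟨b, rfl⟩ := ZMod.intCast_surjective b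
  have hinj : Function.Injective (fun m : ℤ => b + M * m) := by
    intro m m' h
    have h1 : (M : ℤ) ≠ 0 := by exact_mod_cast NeZero.ne M
    have h2 : (M : ℤ) * m = M * m' := add_left_cancel h
    exact mul_left_cancel₀ h1 h2
  rw [← hinj.tsum_eq]
  swap
  · intro d hd
    rw [Function.mem_support] at hd
    have : (d : ZMod M) = b := by
      by_contra h; rw [if_neg h] at hd; exact hd rfl
    have := (ZMod.intCast_eq_intCast_iff_dvd_sub b d M).mp this.symm
    obtain ⟨m, hm⟩ := this
    exact ⟨m, by show b + M * m = d; rw [← hm]; ring⟩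
  let z' : ℍ := ⟨((z : ℂ) + b) / M, by
    rw [show ((z : ℂ) + b) / M = ((z : ℂ) + b) * ((M : ℝ)⁻¹ : ℝ) by push_cast; rfl]
    rw [Complex.im_mul_ofReal]
    have := z.im_pos
    have e : ((z : ℂ) + b).im = z.im := by simp
    rw [e]; positivity⟩
  have h := qExpansion_identity_pnat (k := 2) (by norm_num) z'
  have e1 : ∀ m : ℤ, (if ((b + M * m : ℤ) : ZMod M) = (b : ZMod M) then
      1 / ((z : ℂ) + ((b + M * m : ℤ) : ℂ)) ^ 3 else 0) = ((M : ℂ) ^ 3)⁻¹ * (1 / ((z' : ℂ) + m) ^ (2 + 1)) := by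
    intro m
    rw [if_pos (by simp)]
    have : ((z : ℂ) + ((b + M * m : ℤ) : ℂ)) = M * ((z' : ℂ) + m) := by
      show _ = (M : ℂ) * (((z : ℂ) + b) / M + m)
      push_cast; field_simp; ring
    rw [this, mul_pow, one_div, mul_inv, one_div]
  simp_rw [e1]
  rw [tsum_mul_left, h, show ((-2 * (π : ℂ) * Complex.I) ^ (2 + 1) / (Nat.factorial 2 : ℂ)) = cst from rfl,
    mul_left_comm, ← mul_assoc]
  congr 1
  apply tsum_congr
  intro r
  congr 1
  have : ((r : ℕ) * (b : ZMod M) : ZMod M) = (((r : ℕ) * b : ℤ) : ZMod M) := by push_cast; rfl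
  rw [this, ZMod.stdAddChar_coe]
  unfold Function.Periodic.qParam
  rw [← Complex.exp_nat_mul, ← Complex.exp_nat_mul, ← Complex.exp_add]
  congr 1
  show _ * (_ * (((z : ℂ) + b) / M)) = _
  push_cast
  field_simp
  ring
end Eis

namespace Eis
set_option linter.unusedSectionVars false
open EisensteinSeries
variable {M : ℕ} [NeZero M]

/-- Bernoulli values -/
def ber (M : ℕ) [NeZero M] (t : ZMod M) : ℚ := (Polynomial.bernoulli 3).eval ((t.val : ℚ) / M) / 3

lemma hasSum_ber (t : ZMod M) :
    HasSum (fun d : ℤ => ZMod.stdAddChar (t * d : ZMod M) * (1 / (d : ℂ) ^ 3)) (cst * (ber M t : ℂ)) := by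
  have hM : (M : ℂ) ≠ 0 := by exact_mod_cast NeZero.ne M
  have hx : ((t.val : ℝ) / M) ∈ Set.Icc (0 : ℝ) 1 := by
    have h1 : (0 : ℝ) < M := by exact_mod_cast NeZero.pos M
    have h2 : (t.val : ℝ) < M := by exact_mod_cast ZMod.val_lt t
    constructor
    · positivity
    · rw [div_le_one h1]; exact h2.le
  have h := hasSum_one_div_pow_mul_fourier_mul_bernoulliFun (k := 3) (by norm_num) hx
  convert h using 1
  · ext d
    rw [mul_comm]
    congr 1
    rw [fourier_coe_apply]
    have : (t * d : ZMod M) = (((t.val : ℤ) * d : ℤ) : ZMod M) := by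
      push_cast; simp
    rw [this, ZMod.stdAddChar_coe]
    congr 1
    push_cast
    field_simp
  · have : bernoulliFun 3 ((t.val : ℝ) / M) = ((3 * ber M t : ℚ) : ℝ) := by
      unfold bernoulliFun ber
      rw [mul_div_cancel₀ _ (by norm_num : (3 : ℚ) ≠ 0)]
      have := Polynomial.eval_map_algebraMap (Polynomial.bernoulli 3) ((((t.val : ℚ) / M : ℚ)) : ℝ)
      push_cast at this
      rw [this]
      have h2 := Polynomial.aeval_algebraMap_apply ℝ ((t.val : ℚ) / M) (Polynomial.bernoulli 3)
      simp only [eq_ratCast, Polynomial.coe_aeval_eq_eval] at h2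
      push_cast at h2
      exact h2
    rw [this]
    unfold cst
    push_cast [Nat.factorial]
    ring

open scoped Classical in
lemma const_sum (b : ZMod M) :
    ∑' d : ℤ, (if (d : ZMod M) = b then 1 / (d : ℂ) ^ 3 else 0) =
      cst * ((M : ℂ)⁻¹ * ∑ t : ZMod M, ZMod.stdAddChar (-(t * b)) * (ber M t : ℂ)) := by
  have hM : (M : ℂ) ≠ 0 := by exact_mod_cast NeZero.ne M
  have h := hasSum_sum (s := Finset.univ) (fun (t : ZMod M) _ =>
    ((hasSum_ber t).mul_left ((M : ℂ)⁻¹ * ZMod.stdAddChar (-(t * b)))))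
  have e : (fun d : ℤ => ∑ t : ZMod M, (M : ℂ)⁻¹ * ZMod.stdAddChar (-(t * b)) *
      (ZMod.stdAddChar (t * d : ZMod M) * (1 / (d : ℂ) ^ 3))) =
      fun d : ℤ => (if (d : ZMod M) = b then 1 / (d : ℂ) ^ 3 else 0) := by
    ext d
    have h1 : ∑ t : ZMod M, ZMod.stdAddChar (t * ((d : ZMod M) - b)) =
        if (d : ZMod M) - b = 0 then (Fintype.card (ZMod M) : ℂ) else 0 := by
      exact_mod_cast AddChar.sum_mulShift _ (ZMod.isPrimitive_stdAddChar M)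
    have h2 : ∀ t : ZMod M, (M : ℂ)⁻¹ * ZMod.stdAddChar (-(t * b)) *
      (ZMod.stdAddChar (t * d : ZMod M) * (1 / (d : ℂ) ^ 3)) =
        (M : ℂ)⁻¹ * (1 / (d : ℂ) ^ 3) * ZMod.stdAddChar (t * ((d : ZMod M) - b)) := by
      intro t
      rw [show t * ((d : ZMod M) - b) = -(t * b) + t * d by ring, AddChar.map_add_eq_mul]
      ring
    simp_rw [h2]
    rw [← Finset.mul_sum, h1, ZMod.card]
    simp only [sub_eq_zero]
    split_ifs
    · field_simp
    · simp
  rw [e] at h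
  rw [h.tsum_eq, Finset.mul_sum, Finset.mul_sum]
  refine Finset.sum_congr rfl fun t _ => ?_
  ring

end Eis

namespace Eis
set_option linter.unusedSectionVars false
open EisensteinSeries
variable {M : ℕ} [NeZero M]

open scoped Classical in
/-- pair coefficients -/
def coef (v : Fin 2 → ZMod M) (c r : ℕ) : ℂ :=
  (r : ℂ) ^ 2 * ((if (c : ZMod M) = v 0 then ZMod.stdAddChar ((r : ZMod M) * v 1) else 0) -
    (if (c : ZMod M) = -v 0 then ZMod.stdAddChar ((r : ZMod M) * (-v 1)) else 0))

open scoped Classical in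
/-- the q-expansion -/
def qser (v : Fin 2 → ZMod M) : PowerSeries ℂ := PowerSeries.mk fun n =>
  if n = 0 then
    (if v 0 = 0 then (M : ℂ) ^ 2 * ∑ t : ZMod M, ZMod.stdAddChar (-(t * v 1)) * (ber M t : ℂ) else 0)
  else ∑ x ∈ n.divisorsAntidiagonal, coef v x.1 x.2

/-- normalised series -/
def H (v : Fin 2 → ZMod M) : ℍ → ℂ := ((M : ℂ) ^ 3 * cst⁻¹) • G v

open scoped Classical in
lemma term_pair (v : Fin 2 → ZMod M) (τ : ℍ) (c d : ℤ) :
    term v τ ((finTwoArrowEquiv ℤ).symm (c, d)) =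
      if (c : ZMod M) = v 0 then
        (if (d : ZMod M) = v 1 then 1 / ((c : ℂ) * τ + d) ^ 3 else 0) else 0 := by
  unfold term
  have : ((fun i => (((finTwoArrowEquiv ℤ).symm (c, d) i : ℤ) : ZMod M)) = v) ↔
      (c : ZMod M) = v 0 ∧ (d : ZMod M) = v 1 := by
    rw [funext_iff]
    simp [Fin.forall_fin_two, finTwoArrowEquiv]
  by_cases h0 : (c : ZMod M) = v 0
  · by_cases h1 : (d : ZMod M) = v 1
    · rw [if_pos (this.mpr ⟨h0, h1⟩), if_pos h0, if_pos h1]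
      simp [eisSummand, finTwoArrowEquiv, zpow_neg]
    · rw [if_neg (fun h => h1 (this.mp h).2), if_pos h0, if_neg h1]
  · rw [if_neg (fun h => h0 (this.mp h).1), if_neg h0]

/-- row sums -/
def row (v : Fin 2 → ZMod M) (τ : ℍ) (c : ℤ) : ℂ :=
  ∑' d : ℤ, term v τ ((finTwoArrowEquiv ℤ).symm (c, d))

open scoped Classical in
lemma row_zero (v : Fin 2 → ZMod M) (τ : ℍ) :
    row v τ 0 = cst * ((M : ℂ) ^ 3)⁻¹ * (qser v).coeff 0 := by
  have hM : (M : ℂ) ≠ 0 := by exact_mod_cast NeZero.ne M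
  unfold row
  simp_rw [term_pair]
  simp only [qser, PowerSeries.coeff_mk, if_true, Int.cast_zero, zero_mul, zero_add]
  by_cases h : v 0 = 0
  · simp only [h, if_true]
    rw [const_sum]
    field_simp
  · simp [h, Ne.symm h]

/-- dilation of a point -/
def dil (c : ℕ+) (τ : ℍ) : ℍ := ⟨(c : ℂ) * τ, by
  have h : (0 : ℝ) < (c : ℕ) := by exact_mod_cast c.pos
  have := τ.im_pos
  have e : ((c : ℂ) * (τ : ℂ)).im = (c : ℕ) * τ.im := by
    rw [show ((c : ℂ)) = (((c : ℕ) : ℝ) : ℂ) by push_cast; rfl, Complex.im_ofReal_mul]; rfl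
  rw [e]; positivity⟩

open scoped Classical in
/-- half of the double series -/
def half (u b : ZMod M) (q : ℂ) (x : ℕ+ × ℕ+) : ℂ :=
  (x.2 : ℂ) ^ 2 * (if ((x.1 : ℕ) : ZMod M) = u then ZMod.stdAddChar (((x.2 : ℕ) : ZMod M) * b) else 0) *
    q ^ ((x.1 : ℕ) * (x.2 : ℕ))

lemma summable_half (u b : ZMod M) {q : ℂ} (hq : ‖q‖ < 1) : Summable (half u b q) := by
  have h := (summable_prod_mul_pow 2 hq).norm
  refine Summable.of_norm_bounded h fun x => ?_
  unfold half
  rw [norm_mul, norm_mul, norm_mul]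
  have : ‖(if ((x.1 : ℕ) : ZMod M) = u then (ZMod.stdAddChar (((x.2 : ℕ) : ZMod M) * b) : ℂ) else 0)‖ ≤ 1 := by
    split_ifs
    · simp
    · simp
  have h0 : 0 ≤ ‖((x.2 : ℕ) : ℂ) ^ 2‖ := norm_nonneg _
  exact mul_le_mul_of_nonneg_right (mul_le_of_le_one_right h0 this) (norm_nonneg _)

open scoped Classical in
lemma half_sum (u b : ZMod M) (τ : ℍ) (c : ℕ+) :
    (if ((c : ℕ) : ZMod M) = u then
      ∑' d : ℤ, (if (d : ZMod M) = b then 1 / ((c : ℂ) * τ + d) ^ 3 else 0) else 0) =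
    cst * ((M : ℂ) ^ 3)⁻¹ * ∑' r : ℕ+, half u b (Function.Periodic.qParam (M : ℝ) τ) (c, r) := by
  by_cases h : ((c : ℕ) : ZMod M) = u
  · rw [if_pos h]
    have := inner_sum (dil c τ) b
    have e : ((dil c τ : ℍ) : ℂ) = (c : ℂ) * τ := rfl
    rw [e] at this
    rw [this]
    congr 1
    apply tsum_congr
    intro r
    unfold half
    rw [if_pos h, mul_assoc]
    congr 2
    rw [pow_mul]
    congr 1
    unfold Function.Periodic.qParam
    rw [← Complex.exp_nat_mul]
    congr 1
    ring
  · simp [half, h]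

lemma row_pos (v : Fin 2 → ZMod M) (τ : ℍ) (c : ℕ+) :
    row v τ ((c : ℕ) : ℤ) = cst * ((M : ℂ) ^ 3)⁻¹ *
      ∑' r : ℕ+, half (v 0) (v 1) (Function.Periodic.qParam (M : ℝ) τ) (c, r) := by
  rw [← half_sum]
  unfold row
  simp_rw [term_pair]
  by_cases h : ((c : ℕ) : ZMod M) = v 0
  · simp [h]
  · simp [h]

lemma row_neg (v : Fin 2 → ZMod M) (τ : ℍ) (c : ℕ+) :
    row v τ (-((c : ℕ) : ℤ)) = - (cst * ((M : ℂ) ^ 3)⁻¹ *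
      ∑' r : ℕ+, half (-v 0) (-v 1) (Function.Periodic.qParam (M : ℝ) τ) (c, r)) := by
  rw [← half_sum]
  unfold row
  simp_rw [term_pair]
  by_cases h : ((c : ℕ) : ZMod M) = - v 0
  · have hv : ((-((c : ℕ) : ℤ) : ℤ) : ZMod M) = v 0 := by
      push_cast; rw [h, neg_neg]
    simp only [hv, h, if_true]
    rw [← tsum_neg, ← (Equiv.neg ℤ).tsum_eq]
    apply tsum_congr
    intro d
    simp only [Equiv.neg_apply, Int.cast_neg]
    by_cases h1 : (d : ZMod M) = - v 1
    · rw [if_pos (by rw [h1, neg_neg]), if_pos h1]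
      rw [show (-(((c : ℕ) : ℤ) : ℂ)) * (τ : ℂ) + -(d : ℂ) = -((c : ℂ) * τ + d) by push_cast; ring,
        Odd.neg_pow (by decide), one_div, one_div, inv_neg]
    · rw [if_neg (by intro h2; exact h1 (by rw [← h2, neg_neg])), if_neg h1, neg_zero]
  · have : ¬ (((-((c : ℕ) : ℤ) : ℤ) : ZMod M) = v 0) := by
      intro h2; apply h; rw [← h2]; simp
    simp only [this, h, if_false, tsum_zero, neg_zero]

lemma G_eq_rows (v : Fin 2 → ZMod M) (τ : ℍ) :
    Summable (row v τ) ∧ G v τ = ∑' c : ℤ, row v τ c := by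
  have hs : Summable (fun x : ℤ × ℤ => term v τ ((finTwoArrowEquiv ℤ).symm x)) :=
    (summable_term v τ).comp_injective (finTwoArrowEquiv ℤ).symm.injective
  have h2 : ∑' x : ℤ × ℤ, term v τ ((finTwoArrowEquiv ℤ).symm x) = G v τ :=
    (finTwoArrowEquiv ℤ).symm.tsum_eq (term v τ)
  constructor
  · exact hs.prod
  · rw [← h2, hs.tsum_prod]
    rfl

lemma G_eq (v : Fin 2 → ZMod M) (τ : ℍ) :
    G v τ = cst * ((M : ℂ) ^ 3)⁻¹ * ((qser v).coeff 0 +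
      ∑' x : ℕ+ × ℕ+, coef v (x.1 : ℕ) (x.2 : ℕ) *
        Function.Periodic.qParam (M : ℝ) τ ^ ((x.1 : ℕ) * (x.2 : ℕ))) := by
  have hMp : (0 : ℝ) < M := by exact_mod_cast NeZero.pos M
  have hq : ‖Function.Periodic.qParam (M : ℝ) τ‖ < 1 := Function.Periodic.norm_qParam_lt_one hMp τ.im_pos
  obtain ⟨hr, h1⟩ := G_eq_rows v τ
  have s1 := summable_half (v 0) (v 1) hq
  have s2 := summable_half (-v 0) (-v 1) hq
  have t1 : ∑' c : ℕ+, row v τ ((c : ℕ) : ℤ) = cst * ((M : ℂ) ^ 3)⁻¹ *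
      ∑' x, half (v 0) (v 1) (Function.Periodic.qParam (M : ℝ) τ) x := by
    rw [s1.tsum_prod, ← tsum_mul_left]
    exact tsum_congr fun c => row_pos v τ c
  have t2 : ∑' c : ℕ+, row v τ (-((c : ℕ) : ℤ)) = -(cst * ((M : ℂ) ^ 3)⁻¹ *
      ∑' x, half (-v 0) (-v 1) (Function.Periodic.qParam (M : ℝ) τ) x) := by
    rw [s2.tsum_prod, ← tsum_mul_left, ← tsum_neg]
    exact tsum_congr fun c => row_neg v τ c
  have t3 := s1.tsum_sub s2
  have t4 : ∑' x : ℕ+ × ℕ+, coef v (x.1 : ℕ) (x.2 : ℕ) *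
        Function.Periodic.qParam (M : ℝ) τ ^ ((x.1 : ℕ) * (x.2 : ℕ)) =
      ∑' x : ℕ+ × ℕ+, (half (v 0) (v 1) (Function.Periodic.qParam (M : ℝ) τ) x -
        half (-v 0) (-v 1) (Function.Periodic.qParam (M : ℝ) τ) x) := by
    apply tsum_congr
    intro x
    simp only [half, coef]
    ring
  rw [h1, tsum_int_eq_zero_add_tsum_pnat hr, row_zero, t1, t2, t4, t3]
  ring

lemma H_ex (v : Fin 2 → ZMod M) : Ex M (H v) (qser v) := by
  intro τ
  have hM : (M : ℂ) ≠ 0 := by exact_mod_cast NeZero.ne M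
  have hMp : (0 : ℝ) < M := by exact_mod_cast NeZero.pos M
  have hq : ‖Function.Periodic.qParam (M : ℝ) τ‖ < 1 := Function.Periodic.norm_qParam_lt_one hMp τ.im_pos
  set q := Function.Periodic.qParam (M : ℝ) τ
  have s : Summable (fun x : ℕ+ × ℕ+ => coef v x.1 x.2 * q ^ ((x.1 : ℕ) * (x.2 : ℕ))) := by
    refine ((summable_half (v 0) (v 1) hq).sub (summable_half (-v 0) (-v 1) hq)).congr fun x => ?_
    simp only [half, coef]
    ring
  have e : H v τ = (qser v).coeff 0 + ∑' x : ℕ+ × ℕ+, coef v x.1 x.2 * q ^ ((x.1 : ℕ) * (x.2 : ℕ)) := by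
    simp only [H, Pi.smul_apply, smul_eq_mul]
    rw [G_eq]
    have := cst_ne_zero
    field_simp
    rfl
  have h1 := sigmaAntidiagonalEquivProd.hasSum_iff.mpr s.hasSum
  have h2 := h1.sigma (g := fun n : ℕ+ => (qser v).coeff (n : ℕ) * q ^ (n : ℕ)) ?_
  · have h3 := (hasSum_pnat_iff (f := fun n : ℕ => (qser v).coeff n * q ^ n)).mp h2
    rw [e]
    rw [pow_zero, mul_one, add_comm] at h3
    exact h3
  · intro n
    have h3 := hasSum_fintype (fun x : Nat.divisorsAntidiagonal n => coef v x.1.1 x.1.2 * q ^ (n : ℕ))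
    have h4 : ∑ x : Nat.divisorsAntidiagonal n, coef v x.1.1 x.1.2 * q ^ (n : ℕ) =
        (qser v).coeff (n : ℕ) * q ^ (n : ℕ) := by
      rw [← Finset.sum_mul]
      congr 1
      simp only [qser, PowerSeries.coeff_mk]
      rw [if_neg n.pos.ne']
      exact Finset.sum_coe_sort (Nat.divisorsAntidiagonal n) (fun x => coef v x.1 x.2)
    rw [h4] at h3
    convert h3 using 2 with x
    have := (Nat.mem_divisorsAntidiagonal.mp x.2).1
    show coef v x.1.1 x.1.2 * q ^ (x.1.1 * x.1.2) = _
    rw [this]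

lemma H_slash (v : Fin 2 → ZMod M) (γ : SL(2, ℤ)) :
    H v ∣[(3 : ℤ)] γ = H (Matrix.vecMul v (γ.map (Int.castRingHom (ZMod M))).1) := by
  unfold H
  rw [ModularForm.SL_smul_slash, G_slash]

end Eis

namespace Eis
set_option linter.unusedSectionVars false
variable {M : ℕ} [NeZero M] (S : Semi M)

/-- twist of a vector -/
def tw (v : Fin 2 → ZMod M) : Fin 2 → ZMod M := ![v 0, (S.lam : ZMod M) * v 1]

lemma coef_mem (v : Fin 2 → ZMod M) (c r : ℕ) : coef v c r ∈ S.E := by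
  unfold coef
  refine S.E.mul_mem (S.E.pow_mem (natCast_mem _ _) _) (S.E.sub_mem ?_ ?_)
  · split_ifs
    · exact S.zeta_mem _
    · exact S.E.zero_mem
  · split_ifs
    · exact S.zeta_mem _
    · exact S.E.zero_mem

lemma phi_coef (v : Fin 2 → ZMod M) (c r : ℕ) : S.phi (coef v c r) = coef (tw S v) c r := by
  unfold coef
  have := S.phi_rat_mul ((r : ℚ) ^ 2)
  push_cast at this
  rw [this, map_sub]
  have h0 : tw S v 0 = v 0 := rfl
  have h1 : tw S v 1 = (S.lam : ZMod M) * v 1 := rfl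
  rw [h0, h1]
  congr 2
  · by_cases h : (c : ZMod M) = v 0
    · rw [if_pos h, if_pos h, S.phi_stdAddChar]; congr 1; ring
    · rw [if_neg h, if_neg h, map_zero]
  · by_cases h : (c : ZMod M) = -v 0
    · rw [if_pos h, if_pos h, S.phi_stdAddChar]; congr 1; ring
    · rw [if_neg h, if_neg h, map_zero]

lemma inE_qser (v : Fin 2 → ZMod M) : S.InE (qser v) := by
  intro n
  simp only [qser, PowerSeries.coeff_mk]
  split_ifs
  · refine S.E.mul_mem (S.E.pow_mem (natCast_mem _ _) _) (S.E.sum_mem fun t _ => S.E.mul_mem ?_ ?_)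
    · exact S.zeta_mem _
    · exact S.rat_mem _
  · exact S.E.zero_mem
  · exact S.E.sum_mem fun x _ => coef_mem S v _ _

lemma ser_qser (v : Fin 2 → ZMod M) : S.ser (qser v) = qser (tw S v) := by
  ext n
  simp only [Semi.coeff_ser, qser, PowerSeries.coeff_mk]
  have h0 : tw S v 0 = v 0 := rfl
  rw [h0]
  split_ifs
  · have := S.phi_rat_mul ((M : ℚ) ^ 2)
    push_cast at this
    rw [this, map_sum]
    congr 1
    refine Finset.sum_congr rfl fun t _ => ?_
    rw [mul_comm, S.phi_rat_mul, mul_comm, S.phi_stdAddChar]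
    congr 2
    have h1 : tw S v 1 = (S.lam : ZMod M) * v 1 := rfl
    rw [h1]
    ring
  · simp
  · rw [map_sum]
    exact Finset.sum_congr rfl fun x _ => phi_coef S v _ _

lemma compQ_H (v : Fin 2 → ZMod M) : S.CompQ 3 (H v) (H (tw S v)) := fun g g' r => by
  refine ⟨qser (Matrix.vecMul v (g.map (Int.castRingHom (ZMod M))).1), inE_qser S _, ?_, ?_⟩
  · rw [H_slash]; exact H_ex _
  · rw [H_slash, ser_qser]
    convert H_ex _ using 2
    obtain ⟨r1, r2, r3, r4⟩ := r
    ext i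
    fin_cases i
    · simp [tw, Matrix.vecMul, dotProduct, Fin.sum_univ_two, r1, ← r3]
      ring
    · simp [tw, Matrix.vecMul, dotProduct, Fin.sum_univ_two, r2, r4]
      ring

lemma H_inj (hM : 4 ≤ M) (v : Fin 2 → ZMod M) (h : H v = H (M := M) ![1, 0]) : v = ![1, 0] := by
  have hq : qser v = qser (M := M) ![1, 0] := by
    have h1 := H_ex v
    rw [h] at h1
    exact h1.unique (NeZero.pos M) (H_ex _)
  have c1 := congrArg (PowerSeries.coeff 1) hq
  have c2 := congrArg (PowerSeries.coeff 2) hq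
  have d1 : Nat.divisorsAntidiagonal 1 = {(1, 1)} := rfl
  have d2 : Nat.divisorsAntidiagonal 2 = {(1, 2), (2, 1)} := rfl
  have n1 : ((1 : ZMod M)) ≠ -1 := by
    intro h
    have : ((2 : ℕ) : ZMod M) = 0 := by push_cast; linear_combination h
    rw [ZMod.natCast_eq_zero_iff] at this
    have := Nat.le_of_dvd (by norm_num) this
    omega
  have n2 : ((2 : ZMod M)) ≠ -1 := by
    intro h
    have : ((3 : ℕ) : ZMod M) = 0 := by push_cast; linear_combination h
    rw [ZMod.natCast_eq_zero_iff] at this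
    have := Nat.le_of_dvd (by norm_num) this
    omega
  have n3 : ((2 : ZMod M)) ≠ 1 := by
    intro h
    have : ((1 : ℕ) : ZMod M) = 0 := by push_cast; linear_combination h
    rw [ZMod.natCast_eq_zero_iff] at this
    have := Nat.le_of_dvd (by norm_num) this
    omega
  simp only [qser, PowerSeries.coeff_mk, d1, one_ne_zero, if_false, Finset.sum_singleton, coef] at c1
  simp [n1] at c1
  simp only [qser, PowerSeries.coeff_mk, d2, two_ne_zero, if_false, coef] at c2
  rw [Finset.sum_pair (by decide), Finset.sum_pair (by decide)] at c2
  simp [n1, n2, n3] at c2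
  by_cases h0 : 1 = v 0
  · have e : v 1 = 0 := by
      rw [if_pos h0, if_neg (by rw [← h0]; exact n1), sub_zero] at c1
      apply ZMod.injective_stdAddChar
      rw [c1, AddChar.map_zero_eq_one]
    ext i
    fin_cases i
    · exact h0.symm
    · exact e
  · rw [if_neg h0] at c1
    by_cases h1 : 1 = - v 0
    · exfalso
      have hv : v 0 = -1 := by rw [h1, neg_neg]
      rw [if_pos h1] at c1
      rw [hv] at c2
      simp only [n1, n2, n3, neg_neg, if_false, if_true, sub_zero, zero_sub, add_zero] at c2
      have e : (ZMod.stdAddChar (-(2 * v 1)) : ℂ) = 1 := by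
        rw [show -(2 * v 1) = -v 1 + -v 1 by ring, AddChar.map_add_eq_mul]
        linear_combination (-(ZMod.stdAddChar (-v 1) : ℂ) + 1) * c1
      rw [e] at c2
      norm_num at c2
    · rw [if_neg h1] at c1
      simp at c1

end Eis

section Core
open Eis
set_option linter.unusedSectionVars false
variable {M : ℕ} [NeZero M]

instance gammaNormalInst (M : ℕ) : (CongruenceSubgroup.Gamma M).Normal := Gamma_normal M

/-- forms of level M (with expansions at all cusps) -/
def Lev (M : ℕ) (k : ℤ) (F : ℍ → ℂ) : Prop :=
  (∀ γ ∈ CongruenceSubgroup.Gamma M, F ∣[k] γ = F) ∧ ∀ g : SL(2, ℤ), ∃ p, Ex M (F ∣[k] g) p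

lemma Lev.congr {k : ℤ} {F : ℍ → ℂ} (h : Lev M k F) {g g' : SL(2, ℤ)}
    (e : (g : SL(2, ℤ) ⧸ CongruenceSubgroup.Gamma M) = g') : F ∣[k] g = F ∣[k] g' := by
  have h1 := QuotientGroup.eq.mp e
  have h2 : g' * g⁻¹ ∈ CongruenceSubgroup.Gamma M :=
    (inferInstance : (CongruenceSubgroup.Gamma M).Normal).mem_comm h1
  have h3 := h.1 _ h2
  have : F ∣[k] ((g' * g⁻¹) * g) = F ∣[k] g := by rw [SlashAction.slash_mul, h3]
  rw [← this]
  congr 1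
  group

lemma Lev.mul {k l : ℤ} {F G : ℍ → ℂ} (h : Lev M k F) (h' : Lev M l G) : Lev M (k + l) (F * G) := by
  refine ⟨fun γ hγ => ?_, fun g => ?_⟩
  · rw [ModularForm.mul_slash_SL2, h.1 γ hγ, h'.1 γ hγ]
  · rw [ModularForm.mul_slash_SL2]
    obtain ⟨p, hp⟩ := h.2 g
    obtain ⟨q, hq⟩ := h'.2 g
    exact ⟨_, hp.mul hq⟩

lemma Lev.H (v : Fin 2 → ZMod M) : Lev M 3 (H v) := by
  refine ⟨fun γ hγ => ?_, fun g => ?_⟩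
  · rw [H_slash]
    congr 1
    obtain ⟨h1, h2, h3, h4⟩ := Gamma_mem.mp hγ
    ext i
    fin_cases i
    · simp [Matrix.vecMul, dotProduct, Fin.sum_univ_two, h1, h3]
    · simp [Matrix.vecMul, dotProduct, Fin.sum_univ_two, h2, h4]
  · rw [H_slash]; exact ⟨_, H_ex _⟩

lemma Lev.one : Lev M 0 1 := by
  have h1 : ∀ g : SL(2, ℤ), (1 : ℍ → ℂ) ∣[(0 : ℤ)] g = 1 := fun g => by
    exact ModularForm.is_invariant_one g
  refine ⟨fun γ _ => h1 γ, fun g => ⟨PowerSeries.C 1, ?_⟩⟩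
  rw [h1]
  exact Ex.const M 1

lemma Lev.prodH {ι : Type*} (v : ι → Fin 2 → ZMod M) (s : Finset ι) :
    Lev M (s.card * 3) (∏ i ∈ s, Eis.H (v i)) := by
  classical
  induction s using Finset.induction_on with
  | empty => simpa using Lev.one
  | insert a s ha ih =>
    rw [Finset.prod_insert ha, Finset.card_insert_of_notMem ha]
    have := (Lev.H (v a)).mul ih
    convert this using 1
    push_cast; ring

lemma prod_slash {ι : Type*} {k : ℤ} (F : ι → ℍ → ℂ) (s : Finset ι) (g : SL(2, ℤ)) :
    (∏ i ∈ s, F i) ∣[s.card * k] g = ∏ i ∈ s, (F i ∣[k] g) := by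
  classical
  induction s using Finset.induction_on with
  | empty => simpa using ModularForm.is_invariant_one g
  | insert a s ha ih =>
    rw [Finset.prod_insert ha, Finset.prod_insert ha, Finset.card_insert_of_notMem ha, ← ih,
      ← ModularForm.mul_slash_SL2]
    congr 1
    push_cast; ring

lemma Ex_sum {ι : Type*} (F : ι → ℍ → ℂ) (s : Finset ι) (h : ∀ i ∈ s, ∃ p, Ex M (F i) p) :
    ∃ p, Ex M (∑ i ∈ s, F i) p := by
  classical
  induction s using Finset.induction_on with
  | empty => exact ⟨0, by simpa using Ex.zero M⟩
  | insert a s ha ih =>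
    obtain ⟨p, hp⟩ := h a (Finset.mem_insert_self a s)
    obtain ⟨q, hq⟩ := ih fun i hi => h i (Finset.mem_insert_of_mem hi)
    rw [Finset.sum_insert ha]
    exact ⟨_, hp.add hq⟩

/-- trace to level one -/
def trc {k : ℤ} {F : ℍ → ℂ} (h : Lev M k F) [Fintype (SL(2, ℤ) ⧸ CongruenceSubgroup.Gamma M)] :
    ModularForm 𝒮ℒ k :=
  have inv : ∀ g : SL(2, ℤ), (∑ s : SL(2, ℤ) ⧸ CongruenceSubgroup.Gamma M, F ∣[k] s.out) ∣[k] g =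
      ∑ s : SL(2, ℤ) ⧸ CongruenceSubgroup.Gamma M, F ∣[k] s.out := fun g => by
    rw [SlashAction.sum_slash]
    simp_rw [← SlashAction.slash_mul]
    refine Fintype.sum_equiv (Equiv.mulRight (g : SL(2, ℤ) ⧸ CongruenceSubgroup.Gamma M)) _ _ fun s => ?_
    apply h.congr
    simp
  have ex := Ex_sum (fun s : SL(2, ℤ) ⧸ CongruenceSubgroup.Gamma M => F ∣[k] s.out) Finset.univ
    fun i _ => h.2 _
  { toFun := ∑ s : SL(2, ℤ) ⧸ CongruenceSubgroup.Gamma M, F ∣[k] s.out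
    slash_action_eq' := by
      rintro γ ⟨g, rfl⟩
      exact inv g
    holo' := by
      obtain ⟨p, hp⟩ := ex
      exact hp.mdiff (NeZero.pos M)
    bdd_at_cusps' := by
      intro c hc
      rw [OnePoint.isBoundedAt_iff_forall_SL2Z hc]
      intro g _
      obtain ⟨p, hp⟩ := ex
      rw [inv]
      exact hp.bdd (NeZero.pos M) }

lemma coe_trc {k : ℤ} {F : ℍ → ℂ} (h : Lev M k F) [Fintype (SL(2, ℤ) ⧸ CongruenceSubgroup.Gamma M)] :
    ⇑(trc h) = ∑ s : SL(2, ℤ) ⧸ CongruenceSubgroup.Gamma M, F ∣[k] s.out := rfl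

lemma exists_move (hM : 4 ≤ M) (g : SL(2, ℤ)) (hg : g ∉ CongruenceSubgroup.Gamma M) :
    ∃ v : Fin 2 → ZMod M, H v ∣[(3 : ℤ)] g ≠ H v := by
  by_contra! hc
  apply hg
  have h1 := hc ![1, 0]
  have h2 := congrArg (fun F => F ∣[(3 : ℤ)] ModularGroup.S) (hc ![0, 1])
  simp only [← SlashAction.slash_mul] at h2
  rw [H_slash] at h1
  rw [H_slash, H_slash] at h2
  have e : Matrix.vecMul ![0, 1] (ModularGroup.S.map (Int.castRingHom (ZMod M))).1 = ![1, 0] := by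
    ext i
    fin_cases i <;> simp [Matrix.vecMul, dotProduct, Fin.sum_univ_two, ModularGroup.coe_S]
  rw [e] at h2
  have a1 := H_inj hM _ h1
  have a2 := H_inj hM _ h2
  have b1 := congrFun a1 0
  have b2 := congrFun a1 1
  have b3 := congrFun a2 0
  have b4 := congrFun a2 1
  simp [Matrix.vecMul, dotProduct, Fin.sum_univ_two, ModularGroup.coe_S, Matrix.mul_apply] at b1 b2 b3 b4
  rw [Gamma_mem]
  exact ⟨b1, b2, b4, b3⟩

end Core

section Core2
open Eis
set_option linter.unusedSectionVars false
variable {M : ℕ} [NeZero M] {S : Semi M}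

lemma rel_one_gamma {γ : SL(2, ℤ)} (h : γ ∈ CongruenceSubgroup.Gamma M) : S.Rel 1 γ := by
  obtain ⟨h1, h2, h3, h4⟩ := Gamma_mem.mp h
  simp [Semi.Rel, h1, h2, h3, h4]

lemma Semi.Comp.inv {k : ℤ} {F F' : ℍ → ℂ} (h : S.Comp k F F') {γ : SL(2, ℤ)}
    (hγ : γ ∈ CongruenceSubgroup.Gamma M) : F' ∣[k] γ = F' := by
  obtain ⟨p, h1, h2⟩ := h 1 γ (rel_one_gamma hγ)
  obtain ⟨q, h3, h4⟩ := h 1 1 Semi.Rel.one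
  rw [h1.unique (NeZero.pos M) h3] at h2
  rw [SlashAction.slash_one] at h4
  exact h2.eq_of_same h4

lemma slash_ne_zero {k : ℤ} {F : ℍ → ℂ} (h : F ≠ 0) (g : SL(2, ℤ)) : F ∣[k] g ≠ 0 := by
  intro h0
  apply h
  have := congrArg (fun G => G ∣[k] g⁻¹) h0
  simp only [← SlashAction.slash_mul, SlashAction.zero_slash, mul_inv_cancel,
    SlashAction.slash_one] at this
  exact this

lemma prod_ex_ne {ι : Type*} (F : ι → ℍ → ℂ) (s : Finset ι) (h : ∀ i ∈ s, ∃ p, Ex M (F i) p)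
    (h0 : ∀ i ∈ s, F i ≠ 0) : ∃ p, Ex M (∏ i ∈ s, F i) p ∧ p ≠ 0 := by
  classical
  induction s using Finset.induction_on with
  | empty => exact ⟨PowerSeries.C 1, by rw [Finset.prod_empty]; exact Ex.const M 1, by simp⟩
  | insert a s ha ih =>
    obtain ⟨p, hp⟩ := h a (Finset.mem_insert_self a s)
    obtain ⟨q, hq, hq0⟩ := ih (fun i hi => h i (Finset.mem_insert_of_mem hi))
      (fun i hi => h0 i (Finset.mem_insert_of_mem hi))
    rw [Finset.prod_insert ha]
    exact ⟨_, hp.mul hq, mul_ne_zero (hp.ne_zero (h0 a (Finset.mem_insert_self a s))) hq0⟩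

theorem core_exists (hM : 4 ≤ M) {k : ℤ} {f : ℍ → ℂ} (hf : Lev M k f) :
    ∃ (w : ℤ) (D D' X' : ℍ → ℂ), D ≠ 0 ∧ S.CompQ w D D' ∧ S.Comp (k + w) (f * D) X' := by
  classical
  have : Fintype (SL(2, ℤ) ⧸ CongruenceSubgroup.Gamma M) := Fintype.ofFinite _
  set I : Finset (SL(2, ℤ) ⧸ CongruenceSubgroup.Gamma M) := Finset.univ.erase 1 with hI
  have hmv : ∀ q : SL(2, ℤ) ⧸ CongruenceSubgroup.Gamma M, ∃ v : Fin 2 → ZMod M, q ≠ 1 →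
      H v ∣[(3 : ℤ)] q.out ≠ H v := by
    intro q
    by_cases hq : q = 1
    · exact ⟨0, fun h => absurd hq h⟩
    · obtain ⟨v, hv⟩ := exists_move hM q.out (fun h => hq (by
        rw [← QuotientGroup.eq_one_iff] at h
        rw [← h]
        simp))
      exact ⟨v, fun _ => hv⟩
  choose v hv using hmv
  set B : SL(2, ℤ) ⧸ CongruenceSubgroup.Gamma M → ℍ → ℂ := fun q => H (v q) ∣[(3 : ℤ)] q.out with hB
  have cB : ∀ q, ∃ B', S.CompQ 3 (B q) B' := fun q => by
    simp only [hB, H_slash]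
    exact ⟨_, compQ_H S _⟩
  choose B' hB' using cB
  have cA : ∀ q, ∃ A', S.CompQ 3 (H (v q)) A' := fun q => ⟨_, compQ_H S _⟩
  choose A' hA' using cA
  have cD := Semi.CompQ.prod (fun q => H (v q) - B q) (fun q => A' q - B' q) I
    (fun q _ => (hA' q).sub (hB' q))
  -- the key identity
  have key : f * ∏ q ∈ I, (H (v q) - B q) = ∑ T ∈ I.powerset,
      (⇑(trc (hf.mul (Lev.prodH v (I \ T)))) * ∏ q ∈ T, B q) * ((-1 : ℂ) ^ T.card • (1 : ℍ → ℂ)) := by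
    have e1 : ∑ s : SL(2, ℤ) ⧸ CongruenceSubgroup.Gamma M,
        (f ∣[k] s.out) * ∏ q ∈ I, ((H (v q) ∣[(3 : ℤ)] s.out) - B q)
        = f * ∏ q ∈ I, (H (v q) - B q) := by
      rw [Finset.sum_eq_single 1]
      · have o : ∀ {l : ℤ} {F : ℍ → ℂ}, Lev M l F →
            F ∣[l] (1 : SL(2, ℤ) ⧸ CongruenceSubgroup.Gamma M).out = F := fun {l F} h => by
          have := h.congr (g := (1 : SL(2, ℤ) ⧸ CongruenceSubgroup.Gamma M).out) (g' := 1) (by simp)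
          rw [this, SlashAction.slash_one]
        rw [o hf]
        congr 1
        exact Finset.prod_congr rfl fun q _ => by rw [o (Lev.H (v q))]
      · intro s _ hs
        rw [Finset.prod_eq_zero (i := s)]
        · simp
        · simp [hI, hs]
        · simp [hB]
      · simp
    rw [← e1]
    simp_rw [Finset.prod_sub, Finset.mul_sum]
    rw [Finset.sum_comm]
    refine Finset.sum_congr rfl fun T _ => ?_
    rw [coe_trc, Finset.sum_mul, Finset.sum_mul]
    refine Finset.sum_congr rfl fun s _ => ?_
    rw [ModularForm.mul_slash_SL2, prod_slash]
    have : ((-1 : ℂ) ^ T.card • (1 : ℍ → ℂ)) = (-1) ^ T.card := by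
      ext τ; simp
    rw [this]
    ring
  have hX : ∃ X', S.Comp (k + I.card * 3) (f * ∏ q ∈ I, (H (v q) - B q)) X' := by
    rw [key]
    refine Semi.Comp.sum _ _ fun T hT => ?_
    obtain ⟨t', ht'⟩ := Semi.levelOne_comp (S := S) ((k + ((I \ T).card : ℤ) * 3).toNat + 1)
      (by push_cast; have := Int.self_le_toNat (k + ((I \ T).card : ℤ) * 3); omega)
      (trc (hf.mul (Lev.prodH v (I \ T))))
    have h2 := ht'.mul (Semi.CompQ.prod B B' T (fun q _ => hB' q))
    have h3 := h2.mul ((Semi.CompQ.one (S := S)).smulQ (t := (-1 : ℂ) ^ T.card)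
      (S.E.pow_mem (S.E.neg_mem S.E.one_mem) _))
    refine ⟨(t' * ∏ i ∈ T, B' i) * S.phi ((-1) ^ T.card) • 1, ?_⟩
    convert h3 using 1
    have : (I \ T).card + T.card = I.card := Finset.card_sdiff_add_card_eq_card (Finset.mem_powerset.mp hT)
    rw [← this]
    push_cast
    ring
  obtain ⟨X', hX'⟩ := hX
  refine ⟨_, _, _, X', ?_, cD, hX'⟩
  obtain ⟨p, hp, hp0⟩ := prod_ex_ne (M := M) (fun q => H (v q) - B q) I (fun q _ => by
      have h1 := H_ex (v q)
      have h2 := H_ex (Matrix.vecMul (v q) (q.out.map (Int.castRingHom (ZMod M))).1)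
      rw [← H_slash] at h2
      exact ⟨_, h1.sub h2⟩)
    (fun q hq => by
      have := hv q (by simpa [hI] using hq)
      intro h
      exact this (sub_eq_zero.mp h).symm)
  intro h0
  rw [h0] at hp
  exact hp0 (hp.unique (NeZero.pos M) (Ex.zero M))

lemma two_weights {k : ℤ} (hk : 1 ≤ k) {w : ℤ} {D : ℍ → ℂ}
    (h1 : ∀ γ ∈ CongruenceSubgroup.Gamma M, D ∣[w] γ = D)
    (h2 : ∀ γ ∈ CongruenceSubgroup.Gamma M, D ∣[k + w] γ = D) : D = 0 := by
  ext τ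
  by_contra hD
  have hM0 : (M : ℝ) ≠ 0 := by exact_mod_cast NeZero.ne M
  have key : ∀ j : ℤ, ‖(M : ℂ) * j * (τ : ℂ) + 1‖ = 1 := by
    intro j
    set γ : SL(2, ℤ) := ⟨!![1, 0; (M : ℤ) * j, 1], by simp [Matrix.det_fin_two]⟩ with hγ
    have hm : γ ∈ CongruenceSubgroup.Gamma M := by
      rw [Gamma_mem]; simp [hγ]
    have hm' : γ⁻¹ ∈ CongruenceSubgroup.Gamma M := inv_mem hm
    have e1 := congrFun (h1 γ hm) τ
    have e2 := congrFun (h2 γ hm) τ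
    rw [ModularForm.SL_slash_apply] at e1 e2
    have hd : denom γ τ = (M : ℂ) * j * (τ : ℂ) + 1 := by
      rw [ModularGroup.denom_apply]
      simp [hγ]
    have hd0 : denom γ τ ≠ 0 := denom_ne_zero γ τ
    have e3 : (denom γ τ) ^ (-k) = 1 := by
      rw [neg_add, zpow_add₀ hd0] at e2
      have : D τ * denom γ τ ^ (-k) = D τ := by
        nth_rewrite 2 [← e2]
        rw [← e1]
        rw [e1]
        linear_combination (-(denom γ τ ^ (-k))) * e1
      exact mul_left_cancel₀ (a := D τ) hD (by rw [this, mul_one])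
    rw [← hd]
    have e4 : ‖denom γ τ‖ ^ (-k) = 1 := by rw [← norm_zpow, e3, norm_one]
    rw [zpow_neg, inv_eq_one] at e4
    by_contra hn
    have := (zpow_eq_one_iff_right₀ (norm_nonneg _) hn).mp e4
    omega
  have k1 := congrArg (fun x => x ^ 2) (key 1)
  have k2 := congrArg (fun x => x ^ 2) (key 2)
  simp only [← Complex.normSq_eq_norm_sq, Complex.normSq_apply] at k1 k2
  simp at k1 k2
  have hi := τ.im_pos
  have : (M : ℝ) * τ.im ≠ 0 := mul_ne_zero hM0 hi.ne'
  have : 0 < ((M : ℝ) * τ.im) ^ 2 := by positivity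
  nlinarith [sq_nonneg ((M : ℝ) * τ.re)]

theorem comp_self (hM : 4 ≤ M) {k : ℤ} (hk : 1 ≤ k) {f : ℍ → ℂ} (hf : Lev M k f)
    {p : PowerSeries ℂ} (hp : Ex M f p) (hfix : ∀ n, 1 ≤ n → S.phi (p.coeff n) = p.coeff n) :
    S.Comp k f f := by
  obtain ⟨w, D, D', X', hD, cD, cX⟩ := core_exists (S := S) hM hf
  have hM0 := NeZero.pos M
  set ε : ℂ := S.phi (p.coeff 0) - p.coeff 0 with hε
  have hser : S.ser p = p + PowerSeries.C ε := by
    ext n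
    rw [Semi.coeff_ser, map_add, PowerSeries.coeff_C]
    split_ifs with h
    · subst h; rw [hε]; ring
    · rw [hfix n (by omega), add_zero]
  obtain ⟨pD, eD, d1, d2⟩ := cD 1 1 Semi.Rel.one
  obtain ⟨pX, x1, x2⟩ := cX 1 1 Semi.Rel.one
  rw [SlashAction.slash_one] at d1 d2 x1 x2
  have hpX : pX = p * pD := x1.unique hM0 (hp.mul d1)
  rw [hpX, Semi.ser_mul p eD, hser] at x2
  have hX : X' = f * D' + ε • D' := by
    refine x2.eq_of_same ?_
    have := (hp.mul d2).add (d2.smul ε)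
    convert this using 1
    rw [add_mul, PowerSeries.smul_eq_C_mul]
  have hD' : ∀ γ ∈ CongruenceSubgroup.Gamma M, D' ∣[w] γ = D' := fun γ hγ => cD.comp.inv hγ
  have hz : ε • D' = 0 := by
    refine two_weights (M := M) hk (w := w) (fun γ hγ => ?_) (fun γ hγ => ?_)
    · rw [ModularForm.SL_smul_slash, hD' γ hγ]
    · have h1 := cX.inv hγ
      rw [hX, SlashAction.add_slash, ModularForm.mul_slash_SL2, hf.1 γ hγ, hD' γ hγ] at h1
      exact add_left_cancel h1
  rw [hz, add_zero] at hX
  intro g g' r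
  obtain ⟨q, hq⟩ := hf.2 g
  obtain ⟨q', hq'⟩ := hf.2 g'
  obtain ⟨pD, eD, d1, d2⟩ := cD g g' r
  obtain ⟨pX, x1, x2⟩ := cX g g' r
  rw [ModularForm.mul_slash_SL2] at x1
  rw [hX, ModularForm.mul_slash_SL2] at x2
  have e1 : pX = q * pD := x1.unique hM0 (hq.mul d1)
  have e2 := x2.unique hM0 (hq'.mul d2)
  rw [e1, Semi.ser_mul q eD] at e2
  have h0 : S.ser pD ≠ 0 := Semi.ser_ne_zero eD (d1.ne_zero (slash_ne_zero hD g))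
  refine ⟨q, hq, ?_⟩
  rw [mul_right_cancel₀ h0 e2]
  exact hq'

end Core2

section LevF
set_option linter.unusedSectionVars false
variable {M : ℕ} [NeZero M]

lemma lev_of_form {N : ℕ} [NeZero N] (hNM : N ∣ M) {k : ℤ} (f : ModularForm (Gamma1 N) k) : Lev M k f := by
  have inv : ∀ γ ∈ CongruenceSubgroup.Gamma M, ⇑f ∣[k] γ = ⇑f := by
    intro γ hγ
    rw [ModularForm.SL_slash]
    refine SlashInvariantFormClass.slash_action_eq f _ ⟨γ, ?_, rfl⟩
    obtain ⟨h1, h2, h3, h4⟩ := Gamma_mem.mp hγ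
    have red : ∀ a b : ℤ, (a : ZMod M) = b → (a : ZMod N) = b := fun a b h => by
      rw [ZMod.intCast_eq_intCast_iff] at h ⊢
      exact h.of_dvd (by exact_mod_cast hNM)
    show γ ∈ Gamma1 N
    rw [Gamma1_mem]
    refine ⟨by simpa using red _ 1 (by simpa using h1), by simpa using red _ 1 (by simpa using h4),
      by simpa using red _ 0 (by simpa using h3)⟩
  refine ⟨inv, fun g => ?_⟩
  refine ⟨qExpansion (M : ℝ) (⇑f ∣[k] g), fun τ => ?_⟩
  have hT : (ModularGroup.T ^ (M : ℤ)) ∈ CongruenceSubgroup.Gamma M := by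
    rw [Gamma_mem, ModularGroup.coe_T_zpow]
    simp
  have hper : (⇑f ∣[k] g) ∣[k] (ModularGroup.T ^ (M : ℤ)) = ⇑f ∣[k] g := by
    have h1 := inv _ ((Gamma_normal M).conj_mem _ hT g)
    rw [← SlashAction.slash_mul]
    have : g * ModularGroup.T ^ (M : ℤ) = (g * ModularGroup.T ^ (M : ℤ) * g⁻¹) * g := by group
    rw [this, SlashAction.slash_mul, h1]
  have hper2 : ∀ τ : ℍ, (⇑f ∣[k] g) ((M : ℝ) +ᵥ τ) = (⇑f ∣[k] g) τ := by
    intro τ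
    have := congrFun hper τ
    rw [ModularForm.SL_slash_apply, modular_T_zpow_smul, ModularGroup.denom_apply] at this
    rw [ModularGroup.coe_T_zpow] at this
    simpa using this
  have := UpperHalfPlane.hasSum_qExpansion (h := M) (f := ⇑f ∣[k] g)
    (by exact_mod_cast NeZero.pos M) ?_ ?_ ?_ τ
  · simpa using this
  · intro z
    by_cases hz : 0 < z.im
    · simp only [Function.comp_apply]
      rw [← hper2 (ofComplex z)]
      refine congrArg (⇑f ∣[k] g) ?_
      apply UpperHalfPlane.ext
      have h1 : 0 < (z + ((M : ℝ) : ℂ)).im := by simpa using hz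
      rw [ofComplex_apply_of_im_pos h1, coe_vadd, ofComplex_apply_of_im_pos hz]
      exact add_comm _ _
    · simp only [Function.comp_apply]
      rw [ofComplex_apply_of_im_nonpos (w := z) (by simpa using hz),
        ofComplex_apply_of_im_nonpos (by simpa using hz)]
  · rw [ModularForm.SL_slash]
    exact (ModularFormClass.holo f).slash k _
  · exact ModularFormClass.bdd_at_infty_slash f g

variable {S : Semi M}

lemma Semi.Rel.inv {g g' : SL(2, ℤ)} (h : S.Rel g g') : S.Rel g⁻¹ g'⁻¹ := by
  obtain ⟨a, b, c, d⟩ := h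
  simp only [Semi.Rel, Matrix.SpecialLinearGroup.coe_inv, Matrix.adjugate_fin_two]
  simp [a, b, d, ← c]

/-- diagonal lifts -/
lemma exists_diag (M : ℕ) [NeZero M] (u : (ZMod M)ˣ) : ∃ g : SL(2, ℤ), ((g 0 0 : ℤ) : ZMod M) = (u⁻¹ : (ZMod M)ˣ) ∧
    ((g 0 1 : ℤ) : ZMod M) = 0 ∧ ((g 1 0 : ℤ) : ZMod M) = 0 ∧ ((g 1 1 : ℤ) : ZMod M) = u := by
  obtain ⟨d, hd, hcop⟩ : ∃ d : ℤ, (d : ZMod M) = u ∧ IsCoprime d (M : ℤ) :=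
    ⟨((u : ZMod M).val : ℤ), by simp, Nat.isCoprime_iff_coprime.mpr (ZMod.val_coe_unit_coprime u)⟩
  obtain ⟨a, b, hab⟩ := hcop.pow_right (n := 2)
  refine ⟨⟨!![a, -(b * M); M, d], ?_⟩, ?_, ?_, ?_, ?_⟩
  · rw [Matrix.det_fin_two]; simp; linarith
  · have := congrArg (Int.cast : ℤ → ZMod M) hab
    push_cast at this
    rw [hd] at this
    simp at this
    simpa using (Units.eq_inv_of_mul_eq_one_left ((mul_comm _ _).trans this))
  · simp
  · simp
  · simpa using hd

lemma exists_rel (S : Semi M) (g : SL(2, ℤ)) : ∃ g', S.Rel g g' := by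
  have hg : g ∈ Subgroup.closure {ModularGroup.S, ModularGroup.T} := by
    rw [SpecialLinearGroup.SL2Z_generators]; trivial
  induction hg using Subgroup.closure_induction with
  | mem x hx =>
    rcases hx with rfl | rfl
    · obtain ⟨d, h1, h2, h3, h4⟩ := exists_diag M S.lam
      refine ⟨ModularGroup.S * d, ?_⟩
      simp [Semi.Rel, ModularGroup.coe_S, Matrix.mul_apply, Fin.sum_univ_two, h1, h2, h3, h4]
    · obtain ⟨l, hl⟩ := ZMod.intCast_surjective (S.lam : ZMod M)
      refine ⟨ModularGroup.T ^ l, ?_⟩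
      simp [Semi.Rel, ModularGroup.coe_T_zpow, ModularGroup.coe_T, hl]
  | one => exact ⟨1, Semi.Rel.one⟩
  | mul x y _ _ hx hy =>
    obtain ⟨x', hx⟩ := hx
    obtain ⟨y', hy⟩ := hy
    exact ⟨_, hx.mul hy⟩
  | inv x _ hx =>
    obtain ⟨x', hx⟩ := hx
    exact ⟨_, hx.inv⟩

end LevF

section Gal
variable {M : ℕ} [NeZero M]

lemma std_eq_pow (j : ZMod M) : (ZMod.stdAddChar j : ℂ) = (ZMod.stdAddChar (1 : ZMod M)) ^ j.val := by
  rw [← AddChar.map_nsmul_eq_pow]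
  congr 1
  simp

lemma std_one_prim : IsPrimitiveRoot (ZMod.stdAddChar (1 : ZMod M) : ℂ) M := by
  have := ZMod.stdAddChar_coe (N := M) 1
  have h2 := Complex.isPrimitiveRoot_exp M (NeZero.ne M)
  rw [Int.cast_one] at this
  rw [this]
  simpa using h2

lemma gal_descent (K : Subfield ℂ) (b : ℂ)
    (h : ∀ S : Semi M, (∀ a ∈ K, ∀ x, S.phi (a * x) = a * S.phi x) → S.phi b = b) : b ∈ K := by
  have hp := std_one_prim (M := M)
  set ζ : ℂ := ZMod.stdAddChar (1 : ZMod M) with hζ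
  set L : IntermediateField K ℂ := IntermediateField.adjoin K {ζ} with hL
  have hζL : ζ ∈ L := IntermediateField.mem_adjoin_simple_self K ζ
  have hint : IsIntegral K ζ := hp.isIntegral (NeZero.pos M) |>.tower_top
  have cyc : IsCyclotomicExtension {M} K L := by
    change IsCyclotomicExtension {M} K (IntermediateField.adjoin K {ζ}).toSubalgebra
    rw [IntermediateField.adjoin_simple_toSubalgebra_of_isAlgebraic hint.isAlgebraic]
    exact hp.adjoin_isCyclotomicExtension K
  have gal : IsGalois K L := IsCyclotomicExtension.isGalois {M} K L
  have fin : FiniteDimensional K L := IntermediateField.adjoin.finiteDimensional hint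
  have hbL : b ∈ L := by
    by_contra hb
    have hb' : b ∉ Submodule.span L {(1 : ℂ)} := by
      rw [Submodule.mem_span_singleton]
      rintro ⟨l, hl⟩
      apply hb
      rw [← hl, Algebra.smul_def, mul_one]
      exact l.2
    obtain ⟨F, hF, hF'⟩ := Submodule.exists_le_ker_of_notMem hb'
    have hF1 : F 1 = 0 := hF' (Submodule.subset_span rfl)
    have hlin : ∀ (l : L) (x : ℂ), (F ((l : ℂ) * x) : ℂ) = l * F x := fun l x => by
      have := F.map_smul l x
      rw [Algebra.smul_def] at this
      exact congrArg (fun z : L => (z : ℂ)) this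
    let S : Semi M :=
      { phi := { toFun := fun x => x + (F x : ℂ)
                 map_zero' := by simp
                 map_add' := fun x y => by simp only [map_add]; push_cast; ring }
        lam := 1
        phi_one := by simp [hF1]
        phi_zeta := fun j x => by
          have hj : (ZMod.stdAddChar j : ℂ) ∈ L := by
            rw [std_eq_pow]; exact pow_mem hζL _
          have := hlin ⟨_, hj⟩ x
          simp only [AddMonoidHom.coe_mk, ZeroHom.coe_mk, Units.val_one, one_mul]
          simp only at this
          rw [this]; ring }
    have := h S (fun a ha x => by
      have hj : a ∈ L := L.algebraMap_mem ⟨a, ha⟩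
      have := hlin ⟨_, hj⟩ x
      show a * x + _ = a * (x + _)
      simp only at this
      rw [this]; ring)
    have h2 : b + (F b : ℂ) = b := this
    apply hF
    apply Subtype.ext
    simpa using h2
  obtain ⟨ρ, hρ⟩ := LinearMap.exists_leftInverse_of_injective (Algebra.linearMap L ℂ)
    (LinearMap.ker_eq_bot.mpr (FaithfulSMul.algebraMap_injective L ℂ))
  have hρ1 : ∀ l : L, ρ (l : ℂ) = l := fun l => LinearMap.congr_fun hρ l
  have hlin : ∀ (l : L) (x : ℂ), ρ ((l : ℂ) * x) = l * ρ x := fun l x => by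
    have := ρ.map_smul l x
    rwa [Algebra.smul_def] at this
  have hpL : IsPrimitiveRoot (⟨ζ, hζL⟩ : L) M :=
    IsPrimitiveRoot.of_map_of_injective (f := algebraMap L ℂ) hp (FaithfulSMul.algebraMap_injective L ℂ)
  have fixed : ∀ σ : Gal(L/K), σ ⟨b, hbL⟩ = ⟨b, hbL⟩ := by
    intro σ
    have hσ := IsPrimitiveRoot.autToPow_spec K hpL σ
    let S : Semi M :=
      { phi := { toFun := fun x => (σ (ρ x) : ℂ)
                 map_zero' := by simp
                 map_add' := fun x y => by simp }
        lam := IsPrimitiveRoot.autToPow K hpL σ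
        phi_one := by
          have := hρ1 1
          simp only [OneMemClass.coe_one] at this
          simp [this]
        phi_zeta := fun j x => by
          have hj : (ZMod.stdAddChar j : ℂ) ∈ L := by
            rw [std_eq_pow]; exact pow_mem hζL _
          have h1 := hlin ⟨_, hj⟩ x
          simp only at h1
          simp only [AddMonoidHom.coe_mk, ZeroHom.coe_mk]
          rw [h1, map_mul]
          push_cast
          congr 1
          have h2 : (⟨ZMod.stdAddChar j, hj⟩ : L) = (⟨ζ, hζL⟩ : L) ^ j.val := by
            apply Subtype.ext
            simpa using std_eq_pow j
          rw [h2, map_pow, ← hσ]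
          push_cast
          rw [← pow_mul]
          generalize (IsPrimitiveRoot.autToPow K hpL σ) = l
          rw [hζ, ← AddChar.map_nsmul_eq_pow]
          congr 1
          simp }
    have := h S (fun a ha x => by
      have hj : a ∈ L := L.algebraMap_mem ⟨a, ha⟩
      have h1 := hlin ⟨_, hj⟩ x
      show ((σ (ρ (a * x)) : L) : ℂ) = a * (σ (ρ x) : L)
      simp only at h1
      rw [h1, map_mul]
      push_cast
      congr 1
      have := σ.commutes ⟨a, ha⟩
      exact congrArg (fun z : L => (z : ℂ)) this)
    apply Subtype.ext
    have h2 : ((σ (ρ b) : L) : ℂ) = b := this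
    have h3 := hρ1 ⟨b, hbL⟩
    simp only at h3
    rw [h3] at h2
    exact h2
  rw [← IsGalois.mem_bot_iff_fixed, IntermediateField.mem_bot] at fixed
  obtain ⟨y, hy⟩ := fixed
  have := congrArg (fun z : L => (z : ℂ)) hy
  simp only at this
  rw [← this]
  exact y.2

lemma Semi.inv_mem (S : Semi M) {e : ℂ} (he : e ∈ S.E) (h0 : e ≠ 0) (x : ℂ) :
    S.phi (x / e) = S.phi x / S.phi e := by
  rw [eq_div_iff (S.phi_ne_zero he h0), mul_comm, ← he]
  congr 1
  field_simp

end Gal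

section Gauss

lemma sum_Icc_zmod (c : ℕ) [NeZero c] (F : ZMod c → ℂ) :
    ∑ u ∈ Finset.Icc 1 c, F ((u : ℕ) : ZMod c) = ∑ a : ZMod c, F a := by
  refine Finset.sum_bij (fun u _ => (u : ZMod c)) (fun _ _ => Finset.mem_univ _) ?_ ?_ (fun _ _ => rfl)
  · intro u hu v hv huv
    rw [Finset.mem_Icc] at hu hv
    have h1 : ((u - 1 : ℕ) : ZMod c) = ((v - 1 : ℕ) : ZMod c) := by
      rw [Nat.cast_sub hu.1, Nat.cast_sub hv.1]
      exact congrArg (· - ((1 : ℕ) : ZMod c)) huv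
    rw [ZMod.natCast_eq_natCast_iff'] at h1
    rw [Nat.mod_eq_of_lt (by omega), Nat.mod_eq_of_lt (by omega)] at h1
    omega
  · intro a _
    have hc := NeZero.pos c
    by_cases h : a = 0
    · exact ⟨c, by simp; omega, by simp [h]⟩
    · refine ⟨a.val, ?_, by simp⟩
      rw [Finset.mem_Icc]
      have := ZMod.val_lt a
      have h2 : a.val ≠ 0 := by rwa [Ne, ZMod.val_eq_zero]
      omega

lemma gauss_eq (c : ℕ) [NeZero c] (χ0 : DirichletCharacter ℂ c) :
    ∑ u ∈ Finset.Icc 1 c,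
      χ0 ((u : ℕ) : ZMod c) * Complex.exp (2 * Real.pi * Complex.I * u / c) =
    ∑ a : ZMod c, χ0 a * ZMod.stdAddChar a := by
  rw [← sum_Icc_zmod]
  refine Finset.sum_congr rfl fun u _ => ?_
  have := ZMod.stdAddChar_coe (N := c) (u : ℤ)
  push_cast at this
  rw [this]

lemma gauss_ne_zero (c : ℕ) [NeZero c] (χ0 : DirichletCharacter ℂ c) (h : χ0.conductor = c) :
    ∑ a : ZMod c, χ0 a * ZMod.stdAddChar a ≠ 0 := by
  intro h0
  have h1 : ZMod.dft (⇑χ0) = 0 := by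
    ext k
    have hp : χ0.IsPrimitive := h
    rw [hp.fourierTransform_eq_inv_mul_gaussSum]
    have : gaussSum χ0 ZMod.stdAddChar = 0 := h0
    rw [this]; simp
  have h2 : (⇑χ0 : ZMod c → ℂ) = 0 := by
    simpa using h1
  have := congrFun h2 1
  simp at this

lemma stdAddChar_level {c M : ℕ} [NeZero c] [NeZero M] (h : c ∣ M) (j : ℤ) :
    (ZMod.stdAddChar (j : ZMod c) : ℂ) = ZMod.stdAddChar (((M / c : ℕ) : ZMod M) * (j : ZMod M)) := by
  have h1 : ((M / c : ℕ) : ZMod M) * (j : ZMod M) = ((((M / c : ℕ) : ℤ) * j : ℤ) : ZMod M) := by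
    rw [Int.cast_mul, Int.cast_natCast]
  rw [h1, ZMod.stdAddChar_coe, ZMod.stdAddChar_coe]
  obtain ⟨e, rfl⟩ := h
  have hc : (c : ℂ) ≠ 0 := by exact_mod_cast NeZero.ne c
  have he : (e : ℂ) ≠ 0 := by
    have := NeZero.ne (c * e)
    exact_mod_cast right_ne_zero_of_mul this
  rw [Nat.mul_div_cancel_left _ (NeZero.pos c)]
  congr 1
  push_cast
  field_simp

lemma Semi.phi_stdAddChar_level {c M : ℕ} [NeZero c] [NeZero M] (S : Semi M) (h : c ∣ M) (l j : ℤ)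
    (hl : (l : ZMod M) = S.lam) :
    S.phi (ZMod.stdAddChar (j : ZMod c)) = ZMod.stdAddChar ((l * j : ℤ) : ZMod c) := by
  rw [stdAddChar_level h, S.phi_stdAddChar, stdAddChar_level h, ← hl]
  congr 1
  push_cast
  ring

lemma Semi.phi_gauss {c M : ℕ} [NeZero c] [NeZero M] (S : Semi M) (h : c ∣ M) {K : Subfield ℂ}
    (hK : ∀ a ∈ K, ∀ x, S.phi (a * x) = a * S.phi x) (χ0 : DirichletCharacter ℂ c)
    (hχ : ∀ a, χ0 a ∈ K) (l d : ℤ) (hl : (l : ZMod M) = S.lam) (hld : (l * d : ZMod c) = 1) :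
    S.phi (∑ a : ZMod c, χ0 a * ZMod.stdAddChar a) =
      χ0 (d : ZMod c) * ∑ a : ZMod c, χ0 a * ZMod.stdAddChar a := by
  rw [map_sum, Finset.mul_sum]
  have hu : IsUnit (l : ZMod c) := IsUnit.of_mul_eq_one _ hld
  refine Fintype.sum_equiv (Equiv.mulLeft (hu.unit : (ZMod c)ˣ) |> fun _ => hu.unit.mulLeft) _ _ fun a => ?_
  rw [hK _ (hχ a)]
  obtain ⟨j, rfl⟩ := ZMod.intCast_surjective a
  rw [S.phi_stdAddChar_level h l j hl]
  simp only [Units.mulLeft_apply, IsUnit.unit_spec]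
  rw [← mul_assoc, ← map_mul]
  push_cast
  congr 2
  linear_combination (-(j : ZMod c)) * hld

lemma gauss_mem_E {c M : ℕ} [NeZero c] [NeZero M] (S : Semi M) (h : c ∣ M) {K : Subfield ℂ}
    (hK : ∀ a ∈ K, ∀ x, S.phi (a * x) = a * S.phi x) (χ0 : DirichletCharacter ℂ c)
    (hχ : ∀ a, χ0 a ∈ K) : ∑ a : ZMod c, χ0 a * ZMod.stdAddChar a ∈ S.E := by
  refine S.E.sum_mem fun a _ => S.E.mul_mem ?_ ?_
  · intro x
    have := hK _ (hχ a) 1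
    rw [mul_one, S.phi_one, mul_one] at this
    rw [hK _ (hχ a), this]
  · obtain ⟨j, rfl⟩ := ZMod.intCast_surjective a
    rw [stdAddChar_level h]
    exact S.zeta_mem _

end Gauss

section Final
variable {M : ℕ} [NeZero M]

lemma const_zero {k : ℤ} (hk : 1 ≤ k) {f : ℍ → ℂ} (hf : Lev M k f) {a0 : ℂ} (h : f = fun _ => a0) :
    f = 0 := by
  refine two_weights (M := M) (w := 0) hk ?_ ?_
  · intro γ _
    subst h
    ext τ
    rw [ModularForm.SL_slash_apply]
    simp
  · rw [add_zero]
    exact hf.1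

lemma comp_of_K {N : ℕ} [NeZero N] (hNM : N ∣ M) (hM : 4 ≤ M) {k : ℤ} (hk : 1 ≤ k)
    (f : ModularForm (Gamma1 N) k) {a : ℕ → ℂ} (ha : HasExpansion 1 (⇑f) a) {K : Subfield ℂ}
    (haK : ∀ n, 1 ≤ n → a n ∈ K) (S : Semi M) (hS : ∀ a ∈ K, ∀ x, S.phi (a * x) = a * S.phi x) :
    S.Comp k f f := by
  have hp := ha.ex.level one_pos (NeZero.pos M)
  rw [one_mul] at hp
  refine comp_self hM hk (lev_of_form hNM f) hp fun n hn => ?_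
  have key : ∀ b ∈ K, S.phi b = b := fun b hb => by
    have := hS b hb 1
    rwa [mul_one, S.phi_one, mul_one] at this
  apply key
  simp only [spread, PowerSeries.coeff_mk]
  split_ifs with h
  · obtain ⟨e, rfl⟩ := h
    rw [Nat.mul_div_cancel_left _ (NeZero.pos M)]
    apply haK
    rcases Nat.eq_zero_or_pos e with rfl | h
    · simp at hn
    · exact h
  · exact K.zero_mem

lemma chi_mem {N : ℕ} [NeZero N] (hNM : N ∣ M) (hM : 4 ≤ M) {k : ℤ} (hk : 1 ≤ k)
    (f : ModularForm (Gamma1 N) k) (hf0 : (f : ℍ → ℂ) ≠ 0) {a : ℕ → ℂ} (ha : HasExpansion 1 (⇑f) a)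
    {K : Subfield ℂ} (haK : ∀ n, 1 ≤ n → a n ∈ K) (χ : DirichletCharacter ℂ N)
    (hχf : ∀ γ : SL(2, ℤ), γ ∈ Gamma0 N →
      ⇑f ∣[k] γ = χ ((γ 1 1 : ℤ) : ZMod N) • ⇑f) (d : ZMod N) : χ d ∈ K := by
  by_cases hd : IsUnit d
  swap
  · rw [χ.map_nonunit hd]; exact K.zero_mem
  obtain ⟨n, hn1, hn⟩ : ∃ n, 1 ≤ n ∧ a n ≠ 0 := by
    by_contra! hcon
    apply hf0
    refine const_zero (M := M) (a0 := a 0) hk (lev_of_form hNM f) ?_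
    ext τ
    refine (ha τ).unique ?_
    convert hasSum_single 0 ?_ using 1
    · simp
    · intro b hb
      rw [hcon b (by omega), zero_mul]
  obtain ⟨u, hu⟩ := ZMod.unitsMap_surjective hNM hd.unit
  obtain ⟨γ, h1, h2, h3, h4⟩ := exists_diag M u
  have red : ∀ a b : ℤ, (a : ZMod M) = b → (a : ZMod N) = b := fun a b h => by
    rw [ZMod.intCast_eq_intCast_iff] at h ⊢
    exact h.of_dvd (by exact_mod_cast hNM)
  have hγ : γ ∈ Gamma0 N := by
    rw [Gamma0_mem]
    simpa using red _ 0 (by simpa using h3)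
  have hγd : ((γ 1 1 : ℤ) : ZMod N) = d := by
    have := congrArg (ZMod.castHom hNM (ZMod N)) h4
    rw [map_intCast] at this
    rw [this]
    have h5 := congrArg (fun t : (ZMod N)ˣ => (t : ZMod N)) hu
    simpa [ZMod.unitsMap] using h5
  refine gal_descent (M := M) K _ fun S hS => ?_
  have hcomp := comp_of_K hNM hM hk f ha haK S hS
  obtain ⟨p, hp, hp'⟩ := hcomp γ γ ⟨rfl, by rw [h2, mul_zero], by rw [h3, mul_zero], rfl⟩
  have e1 := hp.unique (NeZero.pos M) hp'
  have hq := ha.ex.level one_pos (NeZero.pos M)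
  rw [one_mul] at hq
  rw [hχf γ hγ, hγd] at hp
  have e2 := hp.unique (NeZero.pos M) (hq.smul (χ d))
  have e3 := congrArg (PowerSeries.coeff (n * M)) e1
  rw [Semi.coeff_ser, e2] at e3
  simp only [PowerSeries.coeff_smul, coeff_spread_mul (NeZero.pos M), PowerSeries.coeff_mk, smul_eq_mul] at e3
  rw [mul_comm, hS _ (haK n hn1)] at e3
  exact (mul_left_cancel₀ hn e3).symm

end Final

section Final2

lemma chiQ0_mem {N Q cQ : ℕ} [NeZero N] [NeZero Q] (hQcop : Nat.gcd Q (N / Q) = 1)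
    (χ : DirichletCharacter ℂ N) (χQ : DirichletCharacter ℂ Q)
    (hχQ : ∀ u v : ℤ, v ≡ u [ZMOD (Q : ℤ)] → v ≡ 1 [ZMOD ((N / Q : ℕ) : ℤ)] →
      χQ (u : ZMod Q) = χ (v : ZMod N))
    (hcQdvd : cQ ∣ Q) (χQ0 : DirichletCharacter ℂ cQ)
    (hind : χQ = DirichletCharacter.changeLevel hcQdvd χQ0) {K : Subfield ℂ}
    (hK : ∀ d, χ d ∈ K) (u : ZMod cQ) : χQ0 u ∈ K := by
  by_cases hu : IsUnit u
  swap
  · rw [χQ0.map_nonunit hu]; exact K.zero_mem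
  obtain ⟨t, ht⟩ := ZMod.unitsMap_surjective hcQdvd hu.unit
  have h5 := congrArg (fun t : (ZMod cQ)ˣ => (t : ZMod cQ)) ht
  have h6 : ((t : ZMod Q).cast : ZMod cQ) = u := by simpa [ZMod.unitsMap] using h5
  have h7 := DirichletCharacter.changeLevel_eq_cast_of_dvd χQ0 hcQdvd t
  rw [← hind, h6] at h7
  rw [← h7]
  obtain ⟨l, hl⟩ := ZMod.intCast_surjective (t : ZMod Q)
  rw [← hl]
  have hco : IsCoprime (Q : ℤ) ((N / Q : ℕ) : ℤ) := Nat.isCoprime_iff_coprime.mpr hQcop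
  obtain ⟨r, s, hrs⟩ := hco
  rw [hχQ l (l + (1 - l) * r * Q) ?_ ?_]
  · exact hK _
  · refine (Int.modEq_iff_dvd.mpr ⟨-((1 - l) * r), by ring⟩)
  · refine (Int.modEq_iff_dvd.mpr ⟨(1 - l) * s, ?_⟩)
    linear_combination (-(1 - l)) * hrs

/-- matrix arithmetic -/
lemma rel_mat {N Q R M : ℕ} [NeZero M] (hR : N = Q * R) (hNM : N ∣ M) (S : Semi M)
    (l : ℤ) (hl : (l : ZMod M) = S.lam) (x y z w : ℤ) (hx : x ≡ 1 [ZMOD (R : ℤ)]) (hy : y ≡ 1 [ZMOD (Q : ℤ)])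
    (hdet : (Q : ℤ) * x * w - R * y * z = 1) (g g' : SL(2, ℤ))
    (hg : (g : Matrix (Fin 2) (Fin 2) ℤ) = !![x, y; R * z, Q * w]) (hr : S.Rel g g') :
    g' * g⁻¹ ∈ Gamma0 N ∧ (g' * g⁻¹) 1 1 ≡ 1 [ZMOD (R : ℤ)] ∧ l * (g' * g⁻¹) 1 1 ≡ 1 [ZMOD (Q : ℤ)] := by
  obtain ⟨h1, h2, h3, h4⟩ := hr
  have hM : ∀ (D : ℕ), D ∣ M → ∀ s t : ℤ, (s : ZMod M) = t → (s : ZMod D) = t := fun D hD s t h => by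
    rw [ZMod.intCast_eq_intCast_iff] at h ⊢
    exact h.of_dvd (by exact_mod_cast hD)
  have hgg : g 0 0 = x ∧ g 0 1 = y ∧ g 1 0 = R * z ∧ g 1 1 = Q * w := by
    rw [hg]; simp
  obtain ⟨g1, g2, g3, g4⟩ := hgg
  rw [g3, ← hl] at h3
  rw [g4] at h4
  have h3' : ((l * g' 1 0 : ℤ) : ZMod M) = ((R * z : ℤ) : ZMod M) := by rw [← h3]; push_cast; rfl
  have e11 : (g' * g⁻¹) 1 1 = - g' 1 0 * y + g' 1 1 * x := by
    simp [Matrix.mul_apply, Fin.sum_univ_two, Matrix.SpecialLinearGroup.coe_inv, Matrix.adjugate_fin_two, hg]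
  have e10 : (g' * g⁻¹) 1 0 = g' 1 0 * (Q * w) - g' 1 1 * (R * z) := by
    simp [Matrix.mul_apply, Fin.sum_univ_two, Matrix.SpecialLinearGroup.coe_inv, Matrix.adjugate_fin_two, hg]
    ring
  have hlu : ∀ D : ℕ, D ∣ M → IsUnit (l : ZMod D) := fun D hD => by
    obtain ⟨m, hm⟩ := ZMod.intCast_surjective ((S.lam⁻¹ : (ZMod M)ˣ) : ZMod M)
    have := hM D hD (l * m) 1 (by push_cast; rw [hl, hm]; simp)
    refine IsUnit.of_mul_eq_one (m : ZMod D) (by exact_mod_cast this)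
  have hQM : Q ∣ M := (Dvd.intro _ hR.symm).trans hNM
  have hRM : R ∣ M := (Dvd.intro_left _ hR.symm).trans hNM
  refine ⟨?_, ?_, ?_⟩
  · rw [Gamma0_mem, e10]
    refine (hlu N hNM).mul_left_cancel ?_
    have a3 := hM N hNM _ _ h3'
    have a4 := hM N hNM _ _ h4
    have hN0 : ((Q : ZMod N) * R) = 0 := by
      rw [← Nat.cast_mul, ← hR]; simp
    push_cast at a3 a4 ⊢
    rw [a4]
    linear_combination (Q * w : ZMod N) * a3 + (z * w - l * w * z) * hN0
  · rw [e11, ← ZMod.intCast_eq_intCast_iff]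
    have a3 := hM R hRM _ _ h3'
    have a4 := hM R hRM _ _ h4
    have ax := (ZMod.intCast_eq_intCast_iff _ _ _).mpr hx
    have ad := congrArg (Int.cast : ℤ → ZMod R) hdet
    have b3 : ((g' 1 0 : ℤ) : ZMod R) = 0 := by
      refine (hlu R hRM).mul_left_cancel ?_
      push_cast at a3
      rw [a3]; simp
    push_cast at a4 ax ad ⊢
    rw [a4, b3]
    simp only [CharP.cast_eq_zero] at ad
    linear_combination ad
  · rw [e11, ← ZMod.intCast_eq_intCast_iff]
    have a3 := hM Q hQM _ _ h3'
    have a4 := hM Q hQM _ _ h4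
    have ad := congrArg (Int.cast : ℤ → ZMod Q) hdet
    push_cast at a3 a4 ad ⊢
    rw [a4]
    simp only [CharP.cast_eq_zero] at ad ⊢
    linear_combination ad - (y : ZMod Q) * a3

/-- the coefficients of the transform -/
lemma coeff_div_mem {N Q R M cQ : ℕ} [NeZero N] [NeZero M] [NeZero cQ] (hR : N = Q * R) (hNM : N ∣ M)
    (hM : 4 ≤ M) {k : ℤ} (hk : 1 ≤ k)
    (f : ModularForm (Gamma1 N) k) {a : ℕ → ℂ} (ha : HasExpansion 1 (⇑f) a)
    {K : Subfield ℂ} (haK : ∀ n, 1 ≤ n → a n ∈ K) (χ : DirichletCharacter ℂ N)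
    (χQ : DirichletCharacter ℂ Q)
    (hχQ : ∀ u v : ℤ, v ≡ u [ZMOD (Q : ℤ)] → v ≡ 1 [ZMOD (R : ℤ)] →
      χQ (u : ZMod Q) = χ (v : ZMod N))
    (hcQdvd : cQ ∣ Q) (χQ0 : DirichletCharacter ℂ cQ)
    (hind : χQ = DirichletCharacter.changeLevel hcQdvd χQ0)
    (hχK : ∀ d, χQ0 d ∈ K) (hprim : χQ0.conductor = cQ)
    (x y z w : ℤ) (hx : x ≡ 1 [ZMOD (R : ℤ)]) (hy : y ≡ 1 [ZMOD (Q : ℤ)])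
    (hdet : (Q : ℤ) * x * w - R * y * z = 1)
    (hχf : ∀ γ : SL(2, ℤ), γ ∈ Gamma0 N →
      ⇑f ∣[k] γ = χ ((γ 1 1 : ℤ) : ZMod N) • ⇑f)
    (g : SL(2, ℤ)) (hg : (g : Matrix (Fin 2) (Fin 2) ℤ) = !![x, y; R * z, Q * w])
    (q : PowerSeries ℂ) (hq : Ex M (⇑f ∣[k] g) q) (n : ℕ) :
    q.coeff n / (∑ a : ZMod cQ, χQ0 a * ZMod.stdAddChar a) ∈ K := by
  have hQM : Q ∣ M := (Dvd.intro _ hR.symm).trans hNM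
  have hcM := hcQdvd.trans hQM
  refine gal_descent (M := M) K _ fun S hS => ?_
  obtain ⟨l, hl⟩ := ZMod.intCast_surjective (S.lam : ZMod M)
  obtain ⟨g', hr⟩ := exists_rel S g
  obtain ⟨m1, m2, m3⟩ := rel_mat hR hNM S l hl x y z w hx hy hdet g g' hg hr
  set d : ℤ := (g' * g⁻¹) 1 1 with hd
  have hdQ : IsUnit ((d : ℤ) : ZMod Q) := by
    have := (ZMod.intCast_eq_intCast_iff _ _ _).mpr m3
    push_cast at this
    exact IsUnit.of_mul_eq_one (l : ZMod Q) (by rw [mul_comm]; exact this)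
  have hchi : χ (d : ZMod N) = χQ0 (d : ZMod cQ) := by
    rw [← hχQ d d rfl m2, hind]
    have := DirichletCharacter.changeLevel_eq_cast_of_dvd χQ0 hcQdvd hdQ.unit
    rw [IsUnit.unit_spec, ZMod.cast_intCast hcQdvd] at this
    exact this
  have hslash : ⇑f ∣[k] g' = χQ0 (d : ZMod cQ) • (⇑f ∣[k] g) := by
    have e : g' = (g' * g⁻¹) * g := by group
    conv_lhs => rw [e]
    rw [SlashAction.slash_mul, hχf _ m1, ← hd, hchi, ModularForm.SL_smul_slash]
  obtain ⟨p, hp, hp'⟩ := comp_of_K hNM hM hk f ha haK S hS g g' hr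
  have e1 := hp.unique (NeZero.pos M) hq
  rw [hslash, e1] at hp'
  have e2 := congrArg (PowerSeries.coeff n) (hp'.unique (NeZero.pos M) (hq.smul _))
  rw [Semi.coeff_ser, PowerSeries.coeff_smul, smul_eq_mul] at e2
  have hG0 := gauss_ne_zero cQ χQ0 hprim
  have hGE := gauss_mem_E S hcM hS χQ0 hχK
  have hld : ((l : ZMod cQ) * (d : ZMod cQ)) = 1 := by
    have := (ZMod.intCast_eq_intCast_iff _ _ _).mpr (m3.of_dvd (m := (cQ : ℤ)) (by exact_mod_cast hcQdvd))
    exact_mod_cast this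
  have hχ0 : χQ0 (d : ZMod cQ) ≠ 0 := by
    have : IsUnit (d : ZMod cQ) := IsUnit.of_mul_eq_one (l : ZMod cQ) (by rw [mul_comm]; exact hld)
    exact (this.map χQ0).ne_zero
  rw [S.inv_mem hGE hG0, e2, S.phi_gauss hcM hS χQ0 hχK l d hl hld, mul_div_mul_left _ _ hχ0]

end Final2

/-- Let `χ` be a Dirichlet character mod `N`, `Q ∥ N`, and `χ_Q` the
`Q`-part of `χ`, with `χ_Q⁰` the primitive character mod `c` (its conductor) inducing it,
and Gauss sum `G'(χ_Q) = Σ_{u=1}^{c} χ_Q⁰(u) e^{2πiu/c}`. With `W_Q` as in the paper, for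
every `f ∈ M_k(Γ₀(N), χ)` every Fourier coefficient of `f|_k W_Q` lies in
`Q^{k/2}·G'(χ_Q)·K_f`. -/
theorem stmt_12 (N Q : ℕ) (hN : 1 ≤ N) (k : ℤ) (hk : 1 ≤ k)
    (hQpos : 0 < Q) (hQdvd : Q ∣ N) (hQcop : Nat.gcd Q (N / Q) = 1)
    (χ : DirichletCharacter ℂ N)
    (χQ : DirichletCharacter ℂ Q)
    (hχQ : ∀ u v : ℤ, v ≡ u [ZMOD (Q : ℤ)] → v ≡ 1 [ZMOD ((N / Q : ℕ) : ℤ)] →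
      χQ (u : ZMod Q) = χ (v : ZMod N))
    (cQ : ℕ) (hcQ : cQ = χQ.conductor)
    (hcQdvd : cQ ∣ Q) (χQ0 : DirichletCharacter ℂ cQ)
    (hind : χQ = DirichletCharacter.changeLevel hcQdvd χQ0)
    (hprim : χQ0.conductor = cQ)
    (G : ℂ)
    (hG : G = ∑ u ∈ Finset.Icc 1 cQ,
      χQ0 ((u : ℕ) : ZMod cQ) * Complex.exp (2 * Real.pi * Complex.I * u / cQ))
    (x y z w : ℤ)
    (hx : x ≡ 1 [ZMOD ((N / Q : ℕ) : ℤ)]) (hy : y ≡ 1 [ZMOD (Q : ℤ)])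
    (hdet : (Q : ℤ) ^ 2 * x * w - N * y * z = Q)
    (f : ModularForm (Gamma1 N) k)
    (hχf : ∀ γ : SL(2, ℤ), γ ∈ Gamma0 N →
      ⇑f ∣[k] γ = χ ((γ 1 1 : ℤ) : ZMod N) • ⇑f)
    (a : ℕ → ℂ) (ha : HasExpansion 1 (⇑f) a)
    (WQf : ℍ → ℂ)
    (hWQf : ∀ τ τ' : ℍ,
      (τ' : ℂ) = ((Q : ℂ) * x * (τ : ℂ) + y) / ((N : ℂ) * z * (τ : ℂ) + Q * w) →
      WQf τ = (Real.sqrt Q : ℂ) ^ k * ((N : ℂ) * z * (τ : ℂ) + Q * w) ^ (-k) * f τ')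
    (c : ℕ → ℂ) (hc : HasExpansion N WQf c) :
    ∀ n : ℕ, ∃ t ∈ Subfield.closure {v : ℂ | ∃ j : ℕ, 1 ≤ j ∧ v = a j},
      c n = (Real.sqrt Q : ℂ) ^ k * G * t := by
  have hNne : NeZero N := ⟨by omega⟩
  have hQne : NeZero Q := ⟨by omega⟩
  have hcne : NeZero cQ := ⟨fun h => by subst h; simp at hcQdvd; omega⟩
  have hMne : NeZero (N * 4) := ⟨by omega⟩
  obtain ⟨R, hR⟩ := hQdvd
  have hRQ : N / Q = R := by rw [hR, Nat.mul_div_cancel_left _ hQpos]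
  set K := Subfield.closure {v : ℂ | ∃ j : ℕ, 1 ≤ j ∧ v = a j} with hKdef
  have haK : ∀ n, 1 ≤ n → a n ∈ K := fun n hn => Subfield.subset_closure ⟨n, hn, rfl⟩
  have hNM : N ∣ N * 4 := Dvd.intro _ rfl
  have hM4 : 4 ≤ N * 4 := by omega
  have hdet' : (Q : ℤ) * x * w - R * y * z = 1 := by
    have hQ0 : (Q : ℤ) ≠ 0 := by exact_mod_cast hQpos.ne'
    refine mul_left_cancel₀ hQ0 ?_
    rw [hR] at hdet
    push_cast at hdet
    linear_combination hdet
  let g : SL(2, ℤ) := ⟨!![x, y; R * z, Q * w], by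
    rw [Matrix.det_fin_two]; simp; linear_combination hdet'⟩
  have hg : (g : Matrix (Fin 2) (Fin 2) ℤ) = !![x, y; R * z, Q * w] := rfl
  obtain ⟨q, hq⟩ := (lev_of_form (M := N * 4) hNM f).2 g
  -- the transform in terms of the slash action
  have hW : ∀ τ τQ : ℍ, (τQ : ℂ) = Q * τ →
      WQf τ = (Real.sqrt Q : ℂ) ^ k * (⇑f ∣[k] g) τQ := by
    intro τ τQ hτ
    have hden : denom g τQ = (N : ℂ) * z * (τ : ℂ) + Q * w := by
      rw [ModularGroup.denom_apply, hτ, hg, hR]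
      simp
      ring
    rw [ModularForm.SL_slash_apply, hden, hWQf τ (g • τQ)]
    · ring
    · rw [← hden, UpperHalfPlane.coe_specialLinearGroup_apply, ModularGroup.denom_apply, hτ]
      simp [hg]
      ring_nf
  have hEx : Ex (N * 4) WQf (((Real.sqrt Q : ℂ) ^ k) • spread Q q) := by
    intro τ
    let τQ : ℍ := ⟨Q * τ, by
      have h1 : (0 : ℝ) < Q := by exact_mod_cast hQpos
      have := mul_pos h1 τ.im_pos
      simpa using this⟩
    have hτ : (τQ : ℂ) = Q * τ := rfl
    have h1 := hq τQ
    have hqp : Function.Periodic.qParam ((N * 4 : ℕ) : ℝ) (τQ : ℂ)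
        = Function.Periodic.qParam ((N * 4 : ℕ) : ℝ) τ ^ Q := by
      rw [Function.Periodic.qParam, Function.Periodic.qParam, ← Complex.exp_nat_mul, hτ]
      congr 1
      ring
    rw [hqp] at h1
    have h2 := hasSum_spread hQpos q _ _ h1
    rw [hW τ τQ hτ]
    refine Eq.mp (congrArg (fun F => HasSum F _) (funext fun n => ?_)) (h2.mul_left ((Real.sqrt Q : ℂ) ^ k))
    rw [PowerSeries.coeff_smul, smul_eq_mul, mul_assoc]
  have hEx2 := hc.ex.level (NeZero.pos N) (by norm_num : 0 < 4)
  have hcoef := hEx2.unique (NeZero.pos (N * 4)) hEx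
  intro n
  have hn := congrArg (PowerSeries.coeff (n * 4)) hcoef
  rw [coeff_spread_mul (by norm_num), PowerSeries.coeff_mk, PowerSeries.coeff_smul, smul_eq_mul] at hn
  by_cases hf0 : (f : ℍ → ℂ) = 0
  · refine ⟨0, K.zero_mem, ?_⟩
    have hq0 : q = 0 := by
      rw [hf0, SlashAction.zero_slash] at hq
      exact hq.unique (NeZero.pos _) (Ex.zero _)
    rw [hn, hq0]
    simp [spread]
  rw [hRQ] at hx
  have hχK := chi_mem hNM hM4 hk f hf0 ha haK χ hχf
  have hχ0K := chiQ0_mem hQcop χ χQ hχQ hcQdvd χQ0 hind hχK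
  rw [hRQ] at hχQ
  have hG0 := gauss_ne_zero cQ χQ0 hprim
  have hfin := coeff_div_mem hR hNM hM4 hk f ha haK χ χQ hχQ hcQdvd χQ0 hind hχ0K hprim
    x y z w hx hy hdet' hχf g hg q hq
  rw [gauss_eq] at hG
  rw [← hG] at hG0 hfin
  by_cases hdv : Q ∣ n * 4
  · refine ⟨_, hfin (n * 4 / Q), ?_⟩
    rw [hn, mul_assoc, mul_div_cancel₀ _ hG0]
    simp [spread, hdv]
  · refine ⟨0, K.zero_mem, ?_⟩
    rw [hn]
    simp [spread, hdv]
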